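/- There exists a constant C depending only on Λ with the following property. Let R > 0 and let u be a positive function, continuous up to the closure of B⁺_{3R}, C¹ on B⁺_{3R} ∪ ∂'B⁺_{3R} and C² in B⁺_{3R}, satisfying Δu + K(x)u⁵ = 0 in B⁺_{3R} and ∂u/∂x₃ = c(x)u³ on ∂'B⁺_{3R}, where K is C¹ on the closure of B⁺_{3R} with Λ⁻¹ ≤ K(x) ≤ Λ and |∇K(x)| ≤ Λ R⁻¹ there, and c is C¹ on ∂'B⁺_{3R} with |c(x)| ≤ Λ and |∇c(x)| ≤ Λ R⁻¹ there. Then (max over the closure of B⁺_R of u) · (min over the closure of B⁺_{2R} of u) ≤ C R⁻¹. -/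

import Mathlib

open Metric Set MeasureTheory

noncomputable section

abbrev E3 := EuclideanSpace ℝ (Fin 3)

/-- The Euclidean Laplacian on ℝ³. -/
noncomputable def lap (u : E3 → ℝ) (x : E3) : ℝ :=
  ∑ i : Fin 3, fderiv ℝ (fun y => fderiv ℝ u y (EuclideanSpace.single i 1)) x
    (EuclideanSpace.single i 1)

/-- The third standard basis vector of ℝ³. -/
noncomputable def e3 : E3 := EuclideanSpace.single 2 1

/-- The open upper half-ball `B⁺_r`. -/
def oB (r : ℝ) : Set E3 := {x | ‖x‖ < r ∧ 0 < x 2}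

/-- The flat boundary part `∂'B⁺_r`. -/
def fB (r : ℝ) : Set E3 := {x | ‖x‖ < r ∧ x 2 = 0}

/-- The closure of the upper half-ball `B⁺_r`. -/
def cB (r : ℝ) : Set E3 := {x | ‖x‖ ≤ r ∧ 0 ≤ x 2}

section MovingSpheres

open Filter Topology

/-- `φ` is differentiable near `0`, with `φ' 0 = d` and `φ'' 0 = a`. -/
def HasJet (φ : ℝ → ℝ) (d a : ℝ) : Prop :=
  ∃ φ' : ℝ → ℝ, (∀ᶠ t in 𝓝 (0 : ℝ), HasDerivAt φ (φ' t) t) ∧ φ' 0 = d ∧ HasDerivAt φ' a 0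

namespace HasJet

variable {φ ψ : ℝ → ℝ} {d a d' a' : ℝ}

lemma hasDerivAt (h : HasJet φ d a) : HasDerivAt φ d 0 := by
  obtain ⟨φ', h1, h2, -⟩ := h
  exact h2 ▸ h1.self_of_nhds

lemma congr_val (h : HasJet φ d a) (hd : d = d') (ha : a = a') : HasJet φ d' a' := hd ▸ ha ▸ h

lemma const (c : ℝ) : HasJet (fun _ => c) 0 0 :=
  ⟨fun _ => 0, Eventually.of_forall fun t => hasDerivAt_const t c, rfl, hasDerivAt_const _ _⟩

lemma quadratic (α β γ : ℝ) : HasJet (fun t => α + β * t + γ * t ^ 2) β (2 * γ) := by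
  refine ⟨fun t => β + 2 * γ * t, Eventually.of_forall fun t => ?_, by simp, ?_⟩
  · have := (((hasDerivAt_id t).const_mul β).const_add α).add (((hasDerivAt_id t).pow 2).const_mul γ)
    refine this.congr_deriv ?_
    simp; ring
  · simpa using ((hasDerivAt_id (0 : ℝ)).const_mul (2 * γ)).const_add β

lemma add (h : HasJet φ d a) (k : HasJet ψ d' a') :
    HasJet (fun t => φ t + ψ t) (d + d') (a + a') := by
  obtain ⟨f, h1, h2, h3⟩ := h
  obtain ⟨g, k1, k2, k3⟩ := k
  refine ⟨fun t => f t + g t, ?_, by simp [h2, k2], h3.add k3⟩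
  filter_upwards [h1, k1] with t ht kt using ht.add kt

lemma mul (h : HasJet φ d a) (k : HasJet ψ d' a') :
    HasJet (fun t => φ t * ψ t) (d * ψ 0 + φ 0 * d') (a * ψ 0 + 2 * d * d' + φ 0 * a') := by
  have h0 := h.hasDerivAt
  have k0 := k.hasDerivAt
  obtain ⟨f, h1, h2, h3⟩ := h
  obtain ⟨g, k1, k2, k3⟩ := k
  refine ⟨fun t => f t * ψ t + φ t * g t, ?_, by simp [h2, k2], ?_⟩
  · filter_upwards [h1, k1] with t ht kt using ht.mul kt
  · refine ((h3.mul k0).add (h0.mul k3)).congr_deriv ?_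
    rw [h2, k2]; ring

lemma const_mul (c : ℝ) (h : HasJet φ d a) : HasJet (fun t => c * φ t) (c * d) (c * a) :=
  ((const c).mul h).congr_val (by ring) (by ring)

lemma sub (h : HasJet φ d a) (k : HasJet ψ d' a') :
    HasJet (fun t => φ t - ψ t) (d - d') (a - a') := by
  have := (h.add (k.const_mul (-1))).congr_val (d' := d - d') (a' := a - a') (by ring) (by ring)
  convert this using 2
  ring

lemma comp {F F' : ℝ → ℝ} {b : ℝ} (hF : ∀ᶠ s in 𝓝 (φ 0), HasDerivAt F (F' s) s)
    (hF' : HasDerivAt F' b (φ 0)) (h : HasJet φ d a) :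
    HasJet (fun t => F (φ t)) (F' (φ 0) * d) (b * d ^ 2 + F' (φ 0) * a) := by
  have h0 := h.hasDerivAt
  obtain ⟨f, h1, h2, h3⟩ := h
  refine ⟨fun t => F' (φ t) * f t, ?_, by simp [h2], ?_⟩
  · filter_upwards [h1, h0.continuousAt.eventually hF] with t ht kt using kt.comp t ht
  · refine ((hF'.comp (0 : ℝ) h0).mul h3).congr_deriv ?_
    rw [h2, Function.comp_apply]; ring

lemma exp (h : HasJet φ d a) :
    HasJet (fun t => Real.exp (φ t)) (Real.exp (φ 0) * d) (Real.exp (φ 0) * (d ^ 2 + a)) :=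
  (h.comp (F := Real.exp) (F' := Real.exp) (Eventually.of_forall Real.hasDerivAt_exp)
    (Real.hasDerivAt_exp _)).congr_val rfl (by ring)

lemma rpow (p : ℝ) (h : HasJet φ d a) (h0 : 0 < φ 0) :
    HasJet (fun t => φ t ^ p) (p * (φ 0 ^ p / φ 0) * d)
      (p * (p - 1) * (φ 0 ^ p / φ 0 ^ 2) * d ^ 2 + p * (φ 0 ^ p / φ 0) * a) := by
  have := h.comp (F := fun s => s ^ p) (F' := fun s => p * s ^ (p - 1))
    (b := p * ((p - 1) * φ 0 ^ (p - 1 - 1)))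
    (by
      filter_upwards [lt_mem_nhds h0] with s hs
      exact Real.hasDerivAt_rpow_const (Or.inl hs.ne'))
    ((Real.hasDerivAt_rpow_const (Or.inl h0.ne')).const_mul p)
  refine this.congr_val ?_ ?_
  · rw [Real.rpow_sub_one h0.ne']
  · rw [Real.rpow_sub_one h0.ne', Real.rpow_sub_one h0.ne']
    field_simp

lemma inv (h : HasJet φ d a) (h0 : φ 0 ≠ 0) :
    HasJet (fun t => (φ t)⁻¹) (-(φ 0 ^ 2)⁻¹ * d)
      (2 * (φ 0 ^ 3)⁻¹ * d ^ 2 - (φ 0 ^ 2)⁻¹ * a) := by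
  have := h.comp (F := fun s => s⁻¹) (F' := fun s => -(s ^ 2)⁻¹) (b := 2 * (φ 0 ^ 3)⁻¹)
    (by
      filter_upwards [isOpen_ne.mem_nhds h0] with s hs using hasDerivAt_inv hs)
    (by
      have h2 := ((hasDerivAt_pow 2 (φ 0)).inv (pow_ne_zero 2 h0)).neg
      refine h2.congr_deriv ?_
      push_cast
      field_simp)
  exact this.congr_val rfl (by ring)

lemma nonneg_of_isLocalMin (h : HasJet φ d a) (hmin : IsLocalMin φ 0) : 0 ≤ a := by
  obtain ⟨f, h1, h2, h3⟩ := h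
  have hd : deriv φ =ᶠ[𝓝 0] f := h1.mono fun t ht => ht.deriv
  have hdd : deriv (deriv φ) 0 = a := hd.deriv_eq.trans h3.deriv
  by_contra! hneg
  have hmax := isLocalMax_of_deriv_deriv_neg (f := φ) (x₀ := 0) (by rw [hdd]; exact hneg)
    hmin.deriv_eq_zero h1.self_of_nhds.continuousAt
  have hconst : φ =ᶠ[𝓝 0] fun _ => φ 0 := by
    filter_upwards [hmin, hmax] with t h1 h2 using le_antisymm h2 h1
  have : deriv φ =ᶠ[𝓝 0] fun _ => 0 := hconst.deriv.trans (by simp)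
  have h0 := this.deriv_eq
  simp [hdd] at h0
  exact hneg.ne h0

end HasJet

lemma norm_sq_coord (z : E3) : ‖z‖ ^ 2 = z 0 ^ 2 + z 1 ^ 2 + z 2 ^ 2 := by
  rw [EuclideanSpace.real_norm_sq_eq, Fin.sum_univ_three]

/-- The `i`-th vector of the standard basis of ℝ³. -/
def bv (i : Fin 3) : E3 := EuclideanSpace.single i 1

lemma bv_apply (i j : Fin 3) : bv i j = if j = i then 1 else 0 := by
  simp [bv]

lemma bv_two : bv 2 = e3 := rfl


lemma sum_coord_bv (z : E3) : z = z 0 • bv 0 + z 1 • bv 1 + z 2 • bv 2 := by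
  ext j; fin_cases j <;> simp [bv_apply]

/-- `f` has two derivatives along the coordinate lines through `y`, the pure second ones adding
up to `L`. -/
def HasLap (f : E3 → ℝ) (y : E3) (L : ℝ) : Prop :=
  ∃ d a : Fin 3 → ℝ, (∀ i, HasJet (fun t => f (y + t • bv i)) (d i) (a i)) ∧ ∑ i, a i = L

namespace HasLap

variable {f g : E3 → ℝ} {y : E3} {L L' : ℝ}

lemma const_mul (c : ℝ) (h : HasLap f y L) : HasLap (fun x => c * f x) y (c * L) := by
  obtain ⟨d, a, h, rfl⟩ := h
  exact ⟨_, _, fun i => (h i).const_mul c, by rw [Finset.mul_sum]⟩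

lemma add (h : HasLap f y L) (k : HasLap g y L') : HasLap (fun x => f x + g x) y (L + L') := by
  obtain ⟨d, a, h, rfl⟩ := h
  obtain ⟨d', a', k, rfl⟩ := k
  exact ⟨_, _, fun i => (h i).add (k i), by rw [Finset.sum_add_distrib]⟩

lemma sub (h : HasLap f y L) (k : HasLap g y L') : HasLap (fun x => f x - g x) y (L - L') := by
  obtain ⟨d, a, h, rfl⟩ := h
  obtain ⟨d', a', k, rfl⟩ := k
  exact ⟨_, _, fun i => (h i).sub (k i), by rw [Finset.sum_sub_distrib]⟩

lemma nonneg_of_isLocalMin (h : HasLap f y L) (hmin : IsLocalMin f y) : 0 ≤ L := by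
  obtain ⟨d, a, h, rfl⟩ := h
  refine Finset.sum_nonneg fun i _ => (h i).nonneg_of_isLocalMin ?_
  have hc : ContinuousAt (fun t : ℝ => y + t • bv i) 0 := by fun_prop
  have : Tendsto (fun t : ℝ => y + t • bv i) (𝓝 0) (𝓝 y) := by simpa [ContinuousAt] using hc
  have := this.eventually hmin
  simpa [IsLocalMin, IsMinFilter] using this

end HasLap

lemma jet_normSq (z : E3) (i : Fin 3) : HasJet (fun t => ‖z + t • bv i‖ ^ 2) (2 * z i) 2 := by
  convert HasJet.quadratic (‖z‖ ^ 2) (2 * z i) 1 using 2 with t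
  · simp only [norm_sq_coord, PiLp.add_apply, PiLp.smul_apply, bv_apply, smul_eq_mul]
    fin_cases i <;> simp <;> ring
  · norm_num

lemma hasJet_comp_curve {u : E3 → ℝ} {γ γ' : ℝ → E3} {w : E3}
    (hu : ContDiffAt ℝ 2 u (γ 0)) (hγ : ∀ᶠ t in 𝓝 (0 : ℝ), HasDerivAt γ (γ' t) t)
    (hγ' : HasDerivAt γ' w 0) :
    HasJet (fun t => u (γ t)) (fderiv ℝ u (γ 0) (γ' 0))
      (fderiv ℝ (fderiv ℝ u) (γ 0) (γ' 0) (γ' 0) + fderiv ℝ u (γ 0) w) := by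
  have hd : ∀ᶠ p in 𝓝 (γ 0), DifferentiableAt ℝ u p :=
    (hu.eventually (by simp)).mono fun p hp => hp.differentiableAt (by simp)
  have hdd : DifferentiableAt ℝ (fderiv ℝ u) (γ 0) :=
    (hu.fderiv_right (m := 1) (by norm_num)).differentiableAt (by simp)
  refine ⟨fun t => fderiv ℝ u (γ t) (γ' t), ?_, rfl, ?_⟩
  · filter_upwards [hγ, hγ.self_of_nhds.continuousAt.eventually hd] with t ht kt
    exact kt.hasFDerivAt.comp_hasDerivAt t ht
  · exact (hdd.hasFDerivAt.comp_hasDerivAt (0 : ℝ) hγ.self_of_nhds).clm_apply hγ'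

lemma hasJet_comp_scaled_line {u : E3 → ℝ} {β : ℝ → ℝ} {b₁ b₂ : ℝ} (x z e : E3)
    (hβ : HasJet β b₁ b₂) (hu : ContDiffAt ℝ 2 u (x + β 0 • z)) :
    HasJet (fun t => u (x + β t • (z + t • e))) (fderiv ℝ u (x + β 0 • z) (b₁ • z + β 0 • e))
      (fderiv ℝ (fderiv ℝ u) (x + β 0 • z) (b₁ • z + β 0 • e) (b₁ • z + β 0 • e) +
        fderiv ℝ u (x + β 0 • z) (b₂ • z + (2 * b₁) • e)) := by
  have hβ0 := hβ.hasDerivAt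
  obtain ⟨f, h1, h2, h3⟩ := hβ
  have hl : ∀ t : ℝ, HasDerivAt (fun t : ℝ => z + t • e) e t := fun t => by
    simpa using ((hasDerivAt_id t).smul_const e).const_add z
  have key := hasJet_comp_curve (u := u) (γ := fun t => x + β t • (z + t • e))
    (γ' := fun t => β t • e + f t • (z + t • e)) (w := b₂ • z + (2 * b₁) • e)
    (by simpa using hu)
    (by
      filter_upwards [h1] with t ht
      exact (ht.smul (hl t)).const_add x)
    (by
      have := (hβ0.smul_const e).add (h3.smul (hl 0))
      refine this.congr_deriv ?_
      rw [h2]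
      simp only [zero_smul, add_zero]
      module)
  simp only [zero_smul, add_zero, h2] at key
  rwa [add_comm (β 0 • e)] at key

lemma lap_eq_of_contDiffAt {u : E3 → ℝ} {p : E3} (hu : ContDiffAt ℝ 2 u p) :
    lap u p = ∑ i, fderiv ℝ (fderiv ℝ u) p (bv i) (bv i) := by
  have hdd : DifferentiableAt ℝ (fderiv ℝ u) p :=
    (hu.fderiv_right (m := 1) (by norm_num)).differentiableAt (by simp)
  refine Finset.sum_congr rfl fun i _ => ?_
  rw [fderiv_clm_apply hdd (differentiableAt_const _)]
  simp [bv]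

lemma ContDiffAt.hasLap {u : E3 → ℝ} {p : E3} (hu : ContDiffAt ℝ 2 u p) :
    HasLap u p (lap u p) := by
  have key := fun i => hasJet_comp_scaled_line (u := u) p 0 (bv i) (HasJet.const 1)
    (by simpa using hu)
  simp only [one_smul, zero_add, smul_zero, zero_smul, mul_zero, add_zero, map_zero] at key
  exact ⟨_, _, key, (lap_eq_of_contDiffAt hu).symm⟩

/-- The inversion of `y` in the sphere of radius `s` about `x`. -/
def kpt (x : E3) (s : ℝ) (y : E3) : E3 := x + (s ^ 2 / ‖y - x‖ ^ 2) • (y - x)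

/-- The Kelvin transform of `u` about the sphere of radius `s` centred at `x`. -/
def kel (u : E3 → ℝ) (x : E3) (s : ℝ) (y : E3) : ℝ := s / ‖y - x‖ * u (kpt x s y)

lemma inv_norm_eq_rpow (z : E3) : (‖z‖ ^ 2) ^ (-(1 / 2) : ℝ) = ‖z‖⁻¹ := by
  rw [Real.rpow_neg (by positivity), ← Real.sqrt_eq_rpow, Real.sqrt_sq (norm_nonneg z)]

lemma clm_apply_eq_sum (l : E3 →L[ℝ] ℝ) (z : E3) :
    l z = z 0 * l (bv 0) + z 1 * l (bv 1) + z 2 * l (bv 2) := by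
  conv_lhs => rw [sum_coord_bv z]
  simp

lemma trace_reflection (D : E3 →L[ℝ] E3 →L[ℝ] ℝ) (z : E3) (α β : ℝ) :
    ∑ i, D ((α * z i) • z + β • bv i) ((α * z i) • z + β • bv i) =
      (α ^ 2 * ‖z‖ ^ 2 + 2 * α * β) * D z z + β ^ 2 * ∑ i, D (bv i) (bv i) := by
  have h1 := clm_apply_eq_sum (D.flip z) z
  have h2 := clm_apply_eq_sum (D z) z
  simp only [ContinuousLinearMap.flip_apply] at h1
  simp only [map_add, map_smul, add_apply, smul_apply,
    smul_eq_mul, Fin.sum_univ_three, norm_sq_coord]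
  linear_combination (-α * β) * h1 + (-α * β) * h2

lemma hasLap_kel {u : E3 → ℝ} {x y : E3} {s : ℝ} (hy : y ≠ x)
    (hu : ContDiffAt ℝ 2 u (kpt x s y)) :
    HasLap (kel u x s) y ((s / ‖y - x‖) ^ 5 * lap u (kpt x s y)) := by
  set z := y - x with hz
  have hz0 : z ≠ 0 := sub_ne_zero.2 hy
  have hn : ‖z‖ ≠ 0 := norm_ne_zero_iff.2 hz0
  have hρ0 : ‖z‖ ^ 2 ≠ 0 := pow_ne_zero 2 hn
  have hρp : 0 < ‖z‖ ^ 2 := by positivity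
  have hρ := jet_normSq z
  have hA : ∀ i, HasJet (fun t => s * (‖z + t • bv i‖ ^ 2) ^ (-(1 / 2) : ℝ))
      (-(s / ‖z‖ ^ 3 * z i)) (s * (3 / ‖z‖ ^ 5 * z i ^ 2 - 1 / ‖z‖ ^ 3)) := fun i => by
    refine (((hρ i).rpow (-(1 / 2)) (by simpa using hρp)).const_mul s).congr_val ?_ ?_
    · simp only [zero_smul, add_zero, inv_norm_eq_rpow]
      field_simp
    · simp only [zero_smul, add_zero, inv_norm_eq_rpow]
      field_simp
      ring
  have hB : ∀ i, HasJet (fun t => s ^ 2 * (‖z + t • bv i‖ ^ 2)⁻¹)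
      (-(2 * s ^ 2 / ‖z‖ ^ 4) * z i) (s ^ 2 * (8 / ‖z‖ ^ 6 * z i ^ 2 - 2 / ‖z‖ ^ 4)) := fun i => by
    refine (((hρ i).inv (by simpa using hz0)).const_mul (s ^ 2)).congr_val ?_ ?_
    · simp only [zero_smul, add_zero]
      field_simp
    · simp only [zero_smul, add_zero]
      field_simp
      ring
  have hk : kpt x s y = x + (s ^ 2 * (‖z‖ ^ 2)⁻¹) • z := by rw [kpt, div_eq_mul_inv]
  set p := kpt x s y with hp
  have hU := fun i => hasJet_comp_scaled_line (u := u) x z (bv i) (hB i)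
    (by simp only [zero_smul, add_zero]; rwa [← hk])
  have key := fun i => (hA i).mul (hU i)
  have hfun : ∀ i, (fun t : ℝ => s * (‖z + t • bv i‖ ^ 2) ^ (-(1 / 2) : ℝ) *
      u (x + (s ^ 2 * (‖z + t • bv i‖ ^ 2)⁻¹) • (z + t • bv i))) =
      fun t => kel u x s (y + t • bv i) := fun i => by
    funext t
    have e1 : y + t • bv i - x = z + t • bv i := by rw [hz]; abel
    rw [kel, kpt, e1, inv_norm_eq_rpow, div_eq_mul_inv, div_eq_mul_inv]
  simp only [hfun] at key
  refine ⟨_, _, key, ?_⟩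
  · simp only [zero_smul, add_zero, ← hk, inv_norm_eq_rpow]
    have hT := trace_reflection (fderiv ℝ (fderiv ℝ u) p) z (-(2 * s ^ 2 / ‖z‖ ^ 4))
      (s ^ 2 * (‖z‖ ^ 2)⁻¹)
    rw [← lap_eq_of_contDiffAt hu] at hT
    have hD := clm_apply_eq_sum (fderiv ℝ u p) z
    rw [Finset.sum_add_distrib, Finset.sum_add_distrib, ← Finset.mul_sum, Finset.sum_add_distrib,
      hT]
    have h2 := norm_sq_coord z
    simp only [Fin.sum_univ_three, map_add, map_smul, smul_eq_mul]
    set n := ‖z‖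
    have e1 : n ^ 2 = z 0 ^ 2 + z 1 ^ 2 + z 2 ^ 2 := h2
    field_simp
    linear_combination (-3 * s * n ^ 2 * u p - 12 * s ^ 3 * fderiv ℝ u p z) * e1 + 6 * s ^ 3 * n ^ 2 * hD

lemma norm_e3 : ‖e3‖ = 1 := by simp [e3]

lemma e3_two : e3 2 = 1 := by simp [e3]

lemma continuous_coord (i : Fin 3) : Continuous fun x : E3 => x i := by fun_prop

lemma abs_coord_le (x : E3) (i : Fin 3) : |x i| ≤ ‖x‖ := by
  simpa using PiLp.norm_apply_le x i

lemma convex_upper : Convex ℝ {x : E3 | 0 ≤ x 2} :=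
  convex_halfSpace_ge (f := fun x : E3 => x 2) ⟨fun _ _ => rfl, fun _ _ => rfl⟩ 0

lemma convex_flat : Convex ℝ {x : E3 | x 2 = 0} :=
  convex_hyperplane (f := fun x : E3 => x 2) ⟨fun _ _ => rfl, fun _ _ => rfl⟩ 0

lemma isClosed_upper : IsClosed {x : E3 | 0 ≤ x 2} :=
  isClosed_le continuous_const (continuous_coord 2)

lemma isOpen_upper : IsOpen {x : E3 | 0 < x 2} :=
  isOpen_lt continuous_const (continuous_coord 2)

lemma cB_eq (r : ℝ) : cB r = closedBall 0 r ∩ {x | 0 ≤ x 2} := by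
  ext x; simp [cB]

lemma oB_eq (r : ℝ) : oB r = ball 0 r ∩ {x | 0 < x 2} := by
  ext x; simp [oB]

lemma fB_eq (r : ℝ) : fB r = ball 0 r ∩ {x | x 2 = 0} := by
  ext x; simp [fB]

lemma oB_union_fB (r : ℝ) : oB r ∪ fB r = ball 0 r ∩ {x | 0 ≤ x 2} := by
  ext x
  simp only [oB, fB, mem_union, mem_ball_zero_iff, mem_inter_iff, mem_ofPred_eq, le_iff_lt_or_eq,
    eq_comm (a := (0 : ℝ))]
  tauto

lemma isCompact_cB (r : ℝ) : IsCompact (cB r) := by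
  rw [cB_eq]; exact (isCompact_closedBall _ _).inter_right isClosed_upper

lemma convex_cB (r : ℝ) : Convex ℝ (cB r) := by
  rw [cB_eq]; exact (convex_closedBall _ _).inter convex_upper

lemma isOpen_oB (r : ℝ) : IsOpen (oB r) := by
  rw [oB_eq]; exact isOpen_ball.inter isOpen_upper

lemma oB_subset_cB (r : ℝ) : oB r ⊆ cB r := fun _ h => ⟨h.1.le, h.2.le⟩

lemma fB_subset_cB (r : ℝ) : fB r ⊆ cB r := fun _ h => ⟨h.1.le, h.2.ge⟩

/-- The properties of a positive solution on a half-ball of radius `r` that are used below, `ℓ`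
being a Lipschitz constant of the two coefficients. -/
structure Sol (r ℓ Λ : ℝ) (u K c : E3 → ℝ) : Prop where
  pos : ∀ x ∈ cB r, 0 < u x
  cont : ContinuousOn u (cB r)
  lip : ∀ x, ‖x‖ < r → 0 ≤ x 2 → ∃ L ρ, 0 ≤ L ∧ 0 < ρ ∧
    ∀ y ∈ cB r, ∀ z ∈ cB r, ‖y - x‖ < ρ → ‖z - x‖ < ρ → |u y - u z| ≤ L * ‖y - z‖
  smooth : ∀ x ∈ oB r, ContDiffAt ℝ 2 u x
  pde : ∀ x ∈ oB r, lap u x + K x * u x ^ 5 = 0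
  bdry : ∀ x ∈ fB r, ∃ D : E3 →L[ℝ] ℝ,
    HasFDerivWithinAt u D {y | 0 ≤ y 2} x ∧ D e3 = c x * u x ^ 3
  K_mem : ∀ x ∈ cB r, Λ⁻¹ ≤ K x ∧ K x ≤ Λ
  K_lip : ∀ x ∈ cB r, ∀ y ∈ cB r, |K x - K y| ≤ ℓ * ‖x - y‖
  c_le : ∀ x ∈ fB r, |c x| ≤ Λ
  c_lip : ∀ x ∈ fB r, ∀ y ∈ fB r, |c x - c y| ≤ ℓ * ‖x - y‖

lemma sol_of_hypotheses {Λ R : ℝ} {u K c : E3 → ℝ}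
    (hpos : ∀ x ∈ cB (3 * R), 0 < u x) (hcont : ContinuousOn u (cB (3 * R)))
    (hu1 : ContDiffOn ℝ 1 u (oB (3 * R) ∪ fB (3 * R))) (hu2 : ContDiffOn ℝ 2 u (oB (3 * R)))
    (hK1 : ContDiffOn ℝ 1 K (cB (3 * R)))
    (hK : ∀ x ∈ cB (3 * R), Λ⁻¹ ≤ K x ∧ K x ≤ Λ ∧
          ‖fderivWithin ℝ K (cB (3 * R)) x‖ ≤ Λ / R)
    (hc1 : ContDiffOn ℝ 1 c (fB (3 * R)))
    (hc : ∀ x ∈ fB (3 * R), |c x| ≤ Λ ∧ ‖fderivWithin ℝ c (fB (3 * R)) x‖ ≤ Λ / R)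
    (hpde : ∀ x ∈ oB (3 * R), lap u x + K x * u x ^ 5 = 0)
    (hbd : ∀ x ∈ fB (3 * R),
          fderivWithin ℝ u (oB (3 * R) ∪ fB (3 * R)) x e3 = c x * u x ^ 3) :
    Sol (3 * R) (Λ / R) Λ u K c where
  pos := hpos
  cont := hcont
  lip x hx hx2 := by
    have hxm : x ∈ oB (3 * R) ∪ fB (3 * R) := by
      rw [oB_union_fB]; exact ⟨by simpa using hx, hx2⟩
    have hconv : Convex ℝ (oB (3 * R) ∪ fB (3 * R)) := by
      rw [oB_union_fB]; exact (convex_ball _ _).inter convex_upper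
    obtain ⟨k, t, ht, hl⟩ := (hu1 x hxm).exists_lipschitzOnWith hconv
    obtain ⟨ρ, hρ, hs⟩ := Metric.mem_nhdsWithin_iff.1 ht
    refine ⟨k, min ρ (3 * R - ‖x‖), k.2, lt_min hρ (by linarith), fun y hy z hz hyx hzx => ?_⟩
    have key : ∀ y ∈ cB (3 * R), ‖y - x‖ < min ρ (3 * R - ‖x‖) → y ∈ t := fun y hy hyx => by
      refine hs ⟨?_, ?_⟩
      · rw [mem_ball, dist_eq_norm]; exact hyx.trans_le (min_le_left _ _)
      · rw [oB_union_fB]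
        refine ⟨?_, hy.2⟩
        have h1 := norm_add_le (y - x) x
        rw [sub_add_cancel] at h1
        have := hyx.trans_le (min_le_right _ _)
        rw [mem_ball_zero_iff]; linarith
    have := hl.dist_le_mul y (key y hy hyx) z (key z hz hzx)
    rwa [Real.dist_eq, dist_eq_norm] at this
  smooth x hx := hu2.contDiffAt ((isOpen_oB _).mem_nhds hx)
  pde := hpde
  bdry x hx := by
    refine ⟨_, ?_, hbd x hx⟩
    have h1 : HasFDerivWithinAt u _ (oB (3 * R) ∪ fB (3 * R)) x :=
      ((hu1 x (Or.inr hx)).differentiableWithinAt (by simp)).hasFDerivWithinAt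
    refine h1.mono_of_mem_nhdsWithin ?_
    rw [oB_union_fB, inter_comm]
    exact inter_mem_nhdsWithin _ (isOpen_ball.mem_nhds (by simpa using hx.1))
  K_mem x hx := ⟨(hK x hx).1, (hK x hx).2.1⟩
  K_lip x hx y hy := (convex_cB _).norm_image_sub_le_of_norm_fderivWithin_le
    (hK1.differentiableOn (by simp)) (fun z hz => (hK z hz).2.2) hy hx
  c_le x hx := (hc x hx).1
  c_lip x hx y hy := by
    have hconv : Convex ℝ (fB (3 * R)) := by
      rw [fB_eq]; exact (convex_ball _ _).inter convex_flat
    exact hconv.norm_image_sub_le_of_norm_fderivWithin_le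
      (hc1.differentiableOn (by simp)) (fun z hz => (hc z hz).2) hy hx

namespace Sol

variable {r ℓ Λ : ℝ} {u K c : E3 → ℝ}

lemma mono {r' : ℝ} (h : Sol r ℓ Λ u K c) (hr : r' ≤ r) : Sol r' ℓ Λ u K c := by
  have h1 : cB r' ⊆ cB r := fun x hx => ⟨hx.1.trans hr, hx.2⟩
  have h2 : oB r' ⊆ oB r := fun x hx => ⟨hx.1.trans_le hr, hx.2⟩
  have h3 : fB r' ⊆ fB r := fun x hx => ⟨hx.1.trans_le hr, hx.2⟩
  refine ⟨fun x hx => h.pos x (h1 hx), h.cont.mono h1, fun x hx hx2 => ?_,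
    fun x hx => h.smooth x (h2 hx), fun x hx => h.pde x (h2 hx), fun x hx => h.bdry x (h3 hx),
    fun x hx => h.K_mem x (h1 hx), fun x hx y hy => h.K_lip x (h1 hx) y (h1 hy),
    fun x hx => h.c_le x (h3 hx), fun x hx y hy => h.c_lip x (h3 hx) y (h3 hy)⟩
  obtain ⟨L, ρ, hL, hρ, hl⟩ := h.lip x (hx.trans_le hr) hx2
  exact ⟨L, ρ, hL, hρ, fun y hy z hz => hl y (h1 hy) z (h1 hz)⟩

end Sol

/-- The rescaling `y ↦ s⁻¹ u(s⁻² y)`, which leaves the critical equations invariant. -/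
def scl (s : ℝ) (u : E3 → ℝ) (y : E3) : ℝ := s⁻¹ * u ((s ^ 2)⁻¹ • y)

lemma fderiv_scl (s : ℝ) (u : E3 → ℝ) (y : E3) :
    fderiv ℝ (scl s u) y = (s⁻¹ * (s ^ 2)⁻¹) • fderiv ℝ u ((s ^ 2)⁻¹ • y) := by
  have : scl s u = s⁻¹ • fun y => u ((s ^ 2)⁻¹ • y) := rfl
  rw [this, fderiv_const_smul_field, Pi.smul_apply, fderiv_comp_smul, smul_smul]

lemma lap_scl (s : ℝ) (u : E3 → ℝ) (y : E3) :
    lap (scl s u) y = s⁻¹ * (s ^ 2)⁻¹ ^ 2 * lap u ((s ^ 2)⁻¹ • y) := by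
  rw [lap, lap, Finset.mul_sum]
  refine Finset.sum_congr rfl fun i _ => ?_
  have : (fun y => fderiv ℝ (scl s u) y (EuclideanSpace.single i 1)) =
      (s⁻¹ * (s ^ 2)⁻¹) •
        fun y => (fun z => fderiv ℝ u z (EuclideanSpace.single i 1)) ((s ^ 2)⁻¹ • y) := by
    funext y
    rw [fderiv_scl]; rfl
  rw [this, fderiv_const_smul_field, Pi.smul_apply,
    fderiv_comp_smul (f := fun z => fderiv ℝ u z (EuclideanSpace.single i 1)), smul_smul]
  simp only [smul_apply, smul_eq_mul]
  ring

lemma Sol.scl {r ℓ Λ s : ℝ} {u K c : E3 → ℝ} (h : Sol r ℓ Λ u K c) (hs : 0 < s) :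
    Sol (s ^ 2 * r) (ℓ / s ^ 2) Λ (scl s u) (fun y => K ((s ^ 2)⁻¹ • y))
      (fun y => c ((s ^ 2)⁻¹ • y)) := by
  have hs2 : 0 < (s ^ 2)⁻¹ := by positivity
  have hn : ∀ y : E3, ‖(s ^ 2)⁻¹ • y‖ = (s ^ 2)⁻¹ * ‖y‖ := fun y => by
    rw [norm_smul, Real.norm_of_nonneg hs2.le]
  have hle : ∀ y : E3, ‖y‖ ≤ s ^ 2 * r → ‖(s ^ 2)⁻¹ • y‖ ≤ r := fun y hy => by
    rw [hn, inv_mul_le_iff₀ (by positivity)]; exact hy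
  have hlt : ∀ y : E3, ‖y‖ < s ^ 2 * r → ‖(s ^ 2)⁻¹ • y‖ < r := fun y hy => by
    rw [hn, inv_mul_lt_iff₀ (by positivity)]; exact hy
  have h1 : ∀ y ∈ cB (s ^ 2 * r), (s ^ 2)⁻¹ • y ∈ cB r := fun y hy =>
    ⟨hle y hy.1, mul_nonneg hs2.le hy.2⟩
  have h2 : ∀ y ∈ oB (s ^ 2 * r), (s ^ 2)⁻¹ • y ∈ oB r := fun y hy =>
    ⟨hlt y hy.1, mul_pos hs2 hy.2⟩
  have h3 : ∀ y ∈ fB (s ^ 2 * r), (s ^ 2)⁻¹ • y ∈ fB r := fun y hy =>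
    ⟨hlt y hy.1, by simp [hy.2]⟩
  have hd : ∀ y z : E3, ‖(s ^ 2)⁻¹ • y - (s ^ 2)⁻¹ • z‖ = (s ^ 2)⁻¹ * ‖y - z‖ := fun y z => by
    rw [← smul_sub, hn]
  refine ⟨fun x hx => mul_pos (inv_pos.2 hs) (h.pos _ (h1 x hx)), ?_, fun x hx hx2 => ?_,
    fun x hx => ?_, fun x hx => ?_, fun x hx => ?_,
    fun x hx => h.K_mem _ (h1 x hx), fun x hx y hy => ?_,
    fun x hx => h.c_le _ (h3 x hx), fun x hx y hy => ?_⟩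
  · exact continuousOn_const.mul (h.cont.comp (by fun_prop) h1)
  · obtain ⟨L, ρ, hL, hρ, hl⟩ := h.lip _ (hlt x hx) (mul_nonneg hs2.le hx2)
    refine ⟨s⁻¹ * (L * (s ^ 2)⁻¹), s ^ 2 * ρ, by positivity, by positivity,
      fun y hy z hz hyx hzx => ?_⟩
    have := hl _ (h1 y hy) _ (h1 z hz)
      (by rw [hd, inv_mul_lt_iff₀ (by positivity)]; exact hyx)
      (by rw [hd, inv_mul_lt_iff₀ (by positivity)]; exact hzx)
    rw [hd] at this
    rw [_root_.scl, _root_.scl, ← mul_sub, abs_mul, abs_of_pos (inv_pos.2 hs), mul_assoc]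
    refine mul_le_mul_of_nonneg_left (this.trans_eq (by ring)) (by positivity)
  · refine contDiffAt_const.mul ?_
    exact ContDiffAt.comp x (h.smooth _ (h2 x hx)) (by fun_prop)
  · rw [lap_scl]
    have := h.pde _ (h2 x hx)
    rw [_root_.scl]
    have e : lap u ((s ^ 2)⁻¹ • x) = - (K ((s ^ 2)⁻¹ • x) * u ((s ^ 2)⁻¹ • x) ^ 5) := by linarith
    rw [e]; ring
  · obtain ⟨D, hD, hD'⟩ := h.bdry _ (h3 x hx)
    have hl : HasFDerivWithinAt (fun y : E3 => (s ^ 2)⁻¹ • y)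
        ((s ^ 2)⁻¹ • ContinuousLinearMap.id ℝ E3) {y | 0 ≤ y 2} x :=
      ((hasFDerivAt_id x).const_smul ((s ^ 2)⁻¹)).hasFDerivWithinAt
    refine ⟨_, (hD.comp x hl fun y hy => mul_nonneg hs2.le hy).const_mul s⁻¹, ?_⟩
    simp only [smul_apply, ContinuousLinearMap.comp_apply, ContinuousLinearMap.id_apply, map_smul,
      smul_eq_mul, hD', _root_.scl]
    ring
  · refine (h.K_lip _ (h1 x hx) _ (h1 y hy)).trans_eq ?_
    rw [hd]; ring
  · refine (h.c_lip _ (h3 x hx) _ (h3 y hy)).trans_eq ?_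
    rw [hd]; ring

section Kelvin

variable {x y : E3} {s : ℝ}

lemma kpt_sub : kpt x s y - x = (s ^ 2 / ‖y - x‖ ^ 2) • (y - x) := by simp [kpt]

lemma norm_kpt_sub (hy : 0 < ‖y - x‖) : ‖kpt x s y - x‖ = s ^ 2 / ‖y - x‖ := by
  rw [kpt_sub, norm_smul, Real.norm_of_nonneg (by positivity)]
  field_simp

lemma norm_kpt_sub_le (hs : 0 < s) (hy : s ≤ ‖y - x‖) : ‖kpt x s y - x‖ ≤ s := by
  rw [norm_kpt_sub (hs.trans_le hy), div_le_iff₀ (hs.trans_le hy)]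
  nlinarith

lemma norm_sub_kpt (hs : 0 < s) (hy : s ≤ ‖y - x‖) :
    ‖y - kpt x s y‖ = (1 - (s / ‖y - x‖) ^ 2) * ‖y - x‖ := by
  have h0 : 0 < ‖y - x‖ := hs.trans_le hy
  have : y - kpt x s y = (1 - (s / ‖y - x‖) ^ 2) • (y - x) := by
    rw [kpt, div_pow]; module
  rw [this, norm_smul, Real.norm_of_nonneg]
  have : s / ‖y - x‖ ≤ 1 := (div_le_one h0).2 hy
  have : 0 ≤ s / ‖y - x‖ := by positivity
  nlinarith

lemma kpt_of_norm_eq (hs : 0 < s) (hy : ‖y - x‖ = s) : kpt x s y = y := by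
  rw [kpt, hy, div_self (by positivity), one_smul, add_sub_cancel]

lemma kpt_two : kpt x s y 2 = x 2 + s ^ 2 / ‖y - x‖ ^ 2 * (y 2 - x 2) := by simp [kpt]

lemma continuousOn_kpt (x : E3) :
    ContinuousOn (fun p : ℝ × E3 => kpt x p.1 p.2) {p | p.2 ≠ x} := by
  have h1 : ContinuousOn (fun p : ℝ × E3 => p.1 ^ 2 / ‖p.2 - x‖ ^ 2) {p | p.2 ≠ x} :=
    ContinuousOn.div (Continuous.continuousOn (by fun_prop)) (Continuous.continuousOn (by fun_prop))
      fun p hp => pow_ne_zero 2 (norm_ne_zero_iff.2 (sub_ne_zero.2 hp))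
  exact continuousOn_const.add (h1.smul (Continuous.continuousOn (by fun_prop)))

end Kelvin

/-- `x` is an admissible centre for spheres of radius up to `l` in the half-ball of radius `r`. -/
structure Centre (r l : ℝ) (x : E3) : Prop where
  pos : 0 < l
  norm_lt : ‖x‖ + l < r
  height : x 2 = 0 ∨ l < x 2

namespace Centre

variable {r l s : ℝ} {x y : E3}

lemma nonneg (h : Centre r l x) : 0 ≤ x 2 := by
  rcases h.height with h1 | h1
  · exact h1.ge
  · exact h.pos.le.trans h1.le

lemma kpt_norm_lt (h : Centre r l x) (hs : 0 < s) (hsl : s ≤ l) (hy : s ≤ ‖y - x‖) :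
    ‖kpt x s y‖ < r := by
  have h1 := norm_add_le (kpt x s y - x) x
  rw [sub_add_cancel] at h1
  have h2 := norm_kpt_sub_le hs hy
  have h3 := h.norm_lt
  linarith

lemma kpt_pos (h : Centre r l x) (hs : 0 < s) (hsl : s ≤ l) (hy : s ≤ ‖y - x‖)
    (hy2 : 0 < y 2 ∨ l < x 2) : 0 < kpt x s y 2 := by
  have key : l < x 2 → 0 < kpt x s y 2 := fun hx => by
    have h1 := abs_coord_le (kpt x s y - x) 2
    have h2 := norm_kpt_sub_le hs hy
    have h3 := neg_abs_le ((kpt x s y - x) 2)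
    simp only [PiLp.sub_apply] at h1 h3
    linarith
  rcases hy2 with hy2 | hx
  · rcases h.height with hx | hx
    · rw [kpt_two, hx]
      have : 0 < ‖y - x‖ := hs.trans_le hy
      simp only [zero_add, sub_zero]
      positivity
    · exact key hx
  · exact key hx

lemma kpt_nonneg (h : Centre r l x) (hs : 0 < s) (hsl : s ≤ l) (hy : s ≤ ‖y - x‖)
    (hy2 : 0 ≤ y 2) : 0 ≤ kpt x s y 2 := by
  rcases h.height with hx | hx
  · rw [kpt_two, hx]
    simp only [zero_add, sub_zero]
    positivity
  · exact (h.kpt_pos hs hsl hy (Or.inr hx)).le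

lemma kpt_mem_cB (h : Centre r l x) (hs : 0 < s) (hsl : s ≤ l) (hy : s ≤ ‖y - x‖)
    (hy2 : 0 ≤ y 2) : kpt x s y ∈ cB r :=
  ⟨(h.kpt_norm_lt hs hsl hy).le, h.kpt_nonneg hs hsl hy hy2⟩

end Centre

/-- A correction term for moving spheres centred at `x`: it is small, has a sufficiently positive
Laplacian and excludes a first contact on the flat part of the boundary. -/
structure Corr (r ℓ m l b : ℝ) (u : E3 → ℝ) (x : E3) (H : ℝ → E3 → ℝ) : Prop where
  cont : ContinuousOn (fun p : ℝ × E3 => H p.1 p.2) {p | 0 < p.1 ∧ p.2 ≠ x}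
  nonneg : ∀ s y, 0 < s → s ≤ l → y ∈ cB r → s ≤ ‖y - x‖ → 0 ≤ H s y
  le : ∀ s y, 0 < s → s ≤ l → y ∈ cB r → s ≤ ‖y - x‖ → H s y ≤ m / 4 * (1 - s / ‖y - x‖)
  lap : ∀ s y, 0 < s → s ≤ l → y ∈ oB r → s < ‖y - x‖ →
    ∃ L, HasLap (H s) y L ∧ 33 * ℓ * s ^ 5 / ‖y - x‖ ^ 4 ≤ L
  flat : ∀ s y ε, 0 < s → s ≤ l → y ∈ fB r → s < ‖y - x‖ → 0 < ε →
    u y + ε = kel u x s y + H s y → u y ≤ 2 * kel u x s y →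
    ∃ d, d < 0 ∧ HasDerivWithinAt (fun t : ℝ => u (y + t • e3) - kel u x s (y + t • e3) -
      H s (y + t • e3) + ε * Real.exp (-b * t)) d (Ici 0) 0

section Moving

variable {r ℓ Λ m l b : ℝ} {u K c : E3 → ℝ} {x : E3} {H : ℝ → E3 → ℝ}

lemma kel_le (hx : Centre r l x) (hu2 : ∀ y ∈ cB r, ‖y - x‖ ≤ l → u y ≤ 2) {s : ℝ} {y : E3}
    (hs : 0 < s) (hsl : s ≤ l) (hy2 : 0 ≤ y 2) (hy : s ≤ ‖y - x‖) :
    kel u x s y ≤ 2 * (s / ‖y - x‖) := by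
  have h1 := hu2 _ (hx.kpt_mem_cB hs hsl hy hy2) ((norm_kpt_sub_le hs hy).trans hsl)
  rw [kel, mul_comm]
  exact mul_le_mul_of_nonneg_right h1 (by positivity)

lemma start_spheres (h : Sol r ℓ Λ u K c) (hx : Centre r l x) (hm : 0 < m)
    (hum : ∀ y ∈ cB r, m ≤ u y) (hu2 : ∀ y ∈ cB r, ‖y - x‖ ≤ l → u y ≤ 2)
    (hH : Corr r ℓ m l b u x H) :
    ∃ s₀, 0 < s₀ ∧ s₀ ≤ l ∧ ∀ s, 0 < s → s ≤ s₀ → ∀ y ∈ cB r, s ≤ ‖y - x‖ →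
      kel u x s y + H s y ≤ u y := by
  have hl := hx.pos
  obtain ⟨L, ρ, hL, hρ, hlip⟩ := h.lip x (by linarith [hx.norm_lt]) hx.nonneg
  refine ⟨min l (min (m / (8 * (L + 1))) (m * ρ / 8)), by positivity, min_le_left _ _,
    fun s hs hss y hy hsy => ?_⟩
  have hsl : s ≤ l := hss.trans (min_le_left _ _)
  have hsL : s * (8 * (L + 1)) ≤ m := by
    rw [← le_div_iff₀ (by positivity)]
    exact (hss.trans (min_le_right _ _)).trans (min_le_left _ _)
  have hsρ : s ≤ m * ρ / 8 := (hss.trans (min_le_right _ _)).trans (min_le_right _ _)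
  have hz : 0 < ‖y - x‖ := hs.trans_le hsy
  have hHle := hH.le s y hs hsl hy hsy
  have hq1 : s / ‖y - x‖ ≤ 1 := (div_le_one hz).2 hsy
  have hq0 : 0 < s / ‖y - x‖ := by positivity
  set q := s / ‖y - x‖ with hq
  have humy := hum y hy
  rcases lt_or_ge ‖y - x‖ ρ with hyρ | hyρ
  · have hk := hlip y hy _ (hx.kpt_mem_cB hs hsl hsy hy.2) hyρ
      (((norm_kpt_sub_le hs hsy).trans hsy).trans_lt hyρ)
    rw [norm_sub_kpt hs hsy, ← hq] at hk
    have hk' := (abs_le.1 hk).1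
    have hqz : q * ‖y - x‖ = s := by rw [hq]; field_simp
    have e1 : q * (L * ((1 - q ^ 2) * ‖y - x‖)) = L * s * (1 - q) * (1 + q) := by
      rw [← hqz]; ring
    have e2 : q * u (kpt x s y) ≤ q * u y + L * s * (1 - q) * (1 + q) := by
      rw [← e1, ← mul_add]
      exact mul_le_mul_of_nonneg_left (by linarith) hq0.le
    have e3 : L * s * (1 - q) * (1 + q) ≤ L * s * (1 - q) * 2 :=
      mul_le_mul_of_nonneg_left (by linarith) (by
        have : 0 ≤ 1 - q := by linarith
        positivity)
    rw [kel, ← hq]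
    have e4 : (1 - q) * m ≤ (1 - q) * u y := mul_le_mul_of_nonneg_left humy (by linarith)
    have e5 : (1 - q) * (8 * L * s) ≤ (1 - q) * m :=
      mul_le_mul_of_nonneg_left (by nlinarith) (by linarith)
    have e6 : 0 ≤ (1 - q) * m := mul_nonneg (by linarith) hm.le
    nlinarith
  · have h1 := kel_le hx hu2 hs hsl hy.2 hsy
    have h2 : q ≤ m / 8 := by
      rw [hq, div_le_iff₀ hz]
      nlinarith
    have h3 : m / 4 * (1 - q) ≤ m / 4 := by nlinarith
    rw [← hq] at h1
    linarith

lemma pow_five_tangent {a b : ℝ} (ha : 0 ≤ a) (hb : 0 ≤ b) :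
    b ^ 5 + 5 * b ^ 4 * (a - b) ≤ a ^ 5 := by
  have : 0 ≤ (a - b) ^ 2 * (a ^ 3 + 2 * a ^ 2 * b + 3 * a * b ^ 2 + 4 * b ^ 3) := by positivity
  nlinarith

lemma hasLap_exp (b : ℝ) (y : E3) :
    HasLap (fun y : E3 => Real.exp (-b * y 2)) y (b ^ 2 * Real.exp (-b * y 2)) := by
  refine ⟨fun i => Real.exp (-b * y 2) * (-b * bv i 2),
    fun i => Real.exp (-b * y 2) * (-b * bv i 2) ^ 2, fun i => ?_, ?_⟩
  · have h := ((HasJet.quadratic (-b * y 2) (-b * bv i 2) 0).exp).congr_val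
      (d' := Real.exp (-b * y 2) * (-b * bv i 2))
      (a' := Real.exp (-b * y 2) * (-b * bv i 2) ^ 2) (by simp) (by simp)
    convert h using 3 with t
    simp only [PiLp.add_apply, PiLp.smul_apply, smul_eq_mul]
    ring
  · simp only [Fin.sum_univ_three, bv_apply]
    simp
    ring

/-- The function whose sign is followed when the spheres are enlarged. -/
def psi (u : E3 → ℝ) (x : E3) (H : ℝ → E3 → ℝ) (b ε s : ℝ) (y : E3) : ℝ :=
  u y - kel u x s y - H s y + ε * Real.exp (-b * y 2)

lemma kel_nonneg (h : Sol r ℓ Λ u K c) (hx : Centre r l x) {s : ℝ} {y : E3}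
    (hs : 0 < s) (hsl : s ≤ l) (hy2 : 0 ≤ y 2) (hy : s ≤ ‖y - x‖) : 0 ≤ kel u x s y :=
  mul_nonneg (by positivity) (h.pos _ (hx.kpt_mem_cB hs hsl hy hy2)).le

lemma no_interior_contact (hΛ : 0 < Λ) (hℓ : 0 ≤ ℓ) (h : Sol r ℓ Λ u K c) (hx : Centre r l x)
    (hu2 : ∀ y ∈ cB r, ‖y - x‖ ≤ l → u y ≤ 2) (hb : 0 ≤ b)
    (hH : Corr r ℓ m l b u x H) {ε s : ℝ} {y : E3} (hs : 0 < s) (hsl : s ≤ l) (hy : y ∈ oB r)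
    (hsy : s < ‖y - x‖) (hε : 0 < ε) (hεs : (80 * Λ + b ^ 2) * ε < ℓ * s ^ 5 / ‖y - x‖ ^ 4)
    (hmin : IsLocalMin (psi u x H b ε s) y) (h0 : psi u x H b ε s y = 0) : False := by
  have hz : 0 < ‖y - x‖ := hs.trans hsy
  have hyx : y ≠ x := fun e => by simp [e] at hz
  have hyc := oB_subset_cB _ hy
  obtain ⟨L, hL, hLle⟩ := hH.lap s y hs hsl hy hsy
  have hkc := hx.kpt_mem_cB hs hsl hsy.le hy.2.le
  have hko : kpt x s y ∈ oB r :=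
    ⟨hx.kpt_norm_lt hs hsl hsy.le, hx.kpt_pos hs hsl hsy.le (Or.inl hy.2)⟩
  have hlap := (((h.smooth y hy).hasLap.sub (hasLap_kel hyx (h.smooth _ hko))).sub hL).add
    ((hasLap_exp b y).const_mul ε)
  have hpos := hlap.nonneg_of_isLocalMin hmin
  have hu := h.pde y hy
  have hU := h.pde _ hko
  have hU0 := kel_nonneg h hx hs hsl hy.2.le hsy.le
  have hUq := kel_le hx hu2 hs hsl hy.2.le hsy.le
  have hHn := hH.nonneg s y hs hsl hyc hsy.le
  have hup := (h.pos y hyc).le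
  have hK1 := h.K_mem y hyc
  have hK2 := (abs_le.1 (h.K_lip y hyc _ hkc)).1
  have hq0 : 0 < s / ‖y - x‖ := by positivity
  have hexp : Real.exp (-b * y 2) ≤ 1 := Real.exp_le_one_iff.2 (by nlinarith [hy.2])
  have hexp0 := Real.exp_pos (-b * y 2)
  have hK0 : 0 < K y := (inv_pos.2 hΛ).trans_le hK1.1
  have hq1 : s / ‖y - x‖ ≤ 1 := (div_le_one hz).2 hsy.le
  have hnk : ‖y - kpt x s y‖ ≤ ‖y - x‖ := by
    rw [norm_sub_kpt hs hsy.le]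
    nlinarith [sq_nonneg (s / ‖y - x‖)]
  have e1 : (s / ‖y - x‖) ^ 5 * lap u (kpt x s y) = - (K (kpt x s y) * kel u x s y ^ 5) := by
    rw [kel, mul_pow]
    linear_combination (s / ‖y - x‖) ^ 5 * hU
  rw [psi] at h0
  rw [e1] at hpos
  set U := kel u x s y
  set E := Real.exp (-b * y 2)
  set q := s / ‖y - x‖ with hq
  have e2 : lap u y = - (K y * u y ^ 5) := by linarith
  rw [e2] at hpos
  have e3 := mul_le_mul_of_nonneg_left (pow_five_tangent hup hU0) hK0.le
  have e4 : u y - U = H s y - ε * E := by linarith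
  rw [e4] at e3
  have hU5 : U ^ 5 ≤ (2 * q) ^ 5 := pow_le_pow_left₀ hU0 hUq 5
  have hU4 : U ^ 4 ≤ 16 := (pow_le_pow_left₀ hU0 (hUq.trans (by linarith : 2 * q ≤ 2)) 4).trans
    (by norm_num)
  have e5 : K (kpt x s y) - K y ≤ ℓ * ‖y - x‖ := by nlinarith
  have e6 : (K (kpt x s y) - K y) * U ^ 5 ≤ ℓ * ‖y - x‖ * (2 * q) ^ 5 :=
    (mul_le_mul_of_nonneg_right e5 (by positivity)).trans
      (mul_le_mul_of_nonneg_left hU5 (by positivity))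
  have e7 : ℓ * ‖y - x‖ * (2 * q) ^ 5 = 32 * (ℓ * s ^ 5 / ‖y - x‖ ^ 4) := by
    rw [hq]; field_simp; ring
  have e8 : 33 * ℓ * s ^ 5 / ‖y - x‖ ^ 4 = 33 * (ℓ * s ^ 5 / ‖y - x‖ ^ 4) := by ring
  rw [e8] at hLle
  rw [e7] at e6
  have e9 : K y * (5 * U ^ 4 * (ε * E)) ≤ 80 * Λ * ε := by
    have a1 : ε * E ≤ ε := by nlinarith
    have a2 : 5 * U ^ 4 * (ε * E) ≤ 80 * ε :=
      mul_le_mul (by linarith) a1 (by positivity) (by norm_num)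
    calc K y * (5 * U ^ 4 * (ε * E)) ≤ Λ * (80 * ε) :=
          mul_le_mul hK1.2 a2 (by positivity) hΛ.le
      _ = _ := by ring
  have e10 : 0 ≤ K y * (5 * U ^ 4 * H s y) := by positivity
  have e11 : ε * (b ^ 2 * E) ≤ b ^ 2 * ε := by
    have : b ^ 2 * ε * E ≤ b ^ 2 * ε * 1 := mul_le_mul_of_nonneg_left hexp (by positivity)
    linarith
  linarith

lemma no_flat_contact (hm : 0 < m) (hum : ∀ y ∈ cB r, m ≤ u y) (hH : Corr r ℓ m l b u x H) {ε s : ℝ} {y : E3} (hs : 0 < s) (hsl : s ≤ l) (hy : y ∈ fB r)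
    (hsy : s < ‖y - x‖) (hε : 0 < ε)
    (hmin : ∀ z ∈ cB r, s ≤ ‖z - x‖ → 0 ≤ psi u x H b ε s z) (h0 : psi u x H b ε s y = 0) :
    False := by
  have hyc := fB_subset_cB _ hy
  have hz : 0 < ‖y - x‖ := hs.trans hsy
  have hyx : y ≠ x := fun e => by simp [e] at hz
  have h0' := h0
  rw [psi, hy.2, mul_zero, Real.exp_zero, mul_one] at h0'
  have hHl := hH.le s y hs hsl hyc hsy.le
  have hmy := hum y hyc
  have hq0 : 0 < s / ‖y - x‖ := by positivity
  obtain ⟨d, hd, hder⟩ := hH.flat s y ε hs hsl hy hsy hε (by linarith) (by nlinarith)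
  have hc : Continuous fun t : ℝ => y + t • e3 := by fun_prop
  have hev : ∀ᶠ t in 𝓝[Ici 0] (0 : ℝ), 0 ≤ psi u x H b ε s (y + t • e3) := by
    have a1 : ∀ᶠ t in 𝓝 (0 : ℝ), ‖y + t • e3‖ < r :=
      (hc.norm.tendsto 0).eventually_lt_const (by simpa using hy.1)
    have a2 : ∀ᶠ t in 𝓝 (0 : ℝ), s < ‖y + t • e3 - x‖ :=
      ((hc.sub continuous_const).norm.tendsto 0).eventually_const_lt (by simpa using hsy)
    filter_upwards [self_mem_nhdsWithin, nhdsWithin_le_nhds a1, nhdsWithin_le_nhds a2] with t t0 t1 t2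
    refine hmin _ ⟨t1.le, ?_⟩ t2.le
    simpa [hy.2, e3_two] using t0
  have hlt := hder.Ioi_of_Ici.limsup_slope_le' (by simp) hd
  obtain ⟨t, ⟨ht, ht'⟩, ht0 : 0 < t⟩ :=
    ((hlt.and (hev.filter_mono (nhdsWithin_mono _ Ioi_subset_Ici_self))).and
      self_mem_nhdsWithin).exists
  have e1 : (y + t • e3) 2 = t := by simp [hy.2, e3_two]
  rw [psi, e1] at ht'
  rw [slope_def_field, zero_smul, add_zero, mul_zero, Real.exp_zero, mul_one, h0', sub_zero,
    sub_zero] at ht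
  exact absurd ht (not_lt.2 (div_nonneg ht' ht0.le))

lemma continuousOn_psi (h : Sol r ℓ Λ u K c) (hx : Centre r l x) (hH : Corr r ℓ m l b u x H)
    (ε : ℝ) : ContinuousOn (fun p : ℝ × E3 => psi u x H b ε p.1 p.2)
      {p | 0 < p.1 ∧ p.1 ≤ l ∧ p.2 ∈ cB r ∧ p.1 ≤ ‖p.2 - x‖} := by
  have hne : ∀ p : ℝ × E3, 0 < p.1 ∧ p.1 ≤ l ∧ p.2 ∈ cB r ∧ p.1 ≤ ‖p.2 - x‖ → p.2 ≠ x := by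
    rintro p ⟨h1, -, -, h2⟩ e
    rw [e, sub_self, norm_zero] at h2
    linarith
  unfold psi kel
  refine (((h.cont.comp continuousOn_snd fun p hp => hp.2.2.1).sub (ContinuousOn.mul
    (ContinuousOn.div (by fun_prop) (Continuous.continuousOn (by fun_prop)) fun p hp => ?_) ?_)).sub
    (hH.cont.mono fun p hp => ⟨hp.1, hne p hp⟩)).add (Continuous.continuousOn (by fun_prop))
  · exact norm_ne_zero_iff.2 (sub_ne_zero.2 (hne p hp))
  · exact h.cont.comp ((continuousOn_kpt x).mono hne) fun p hp =>
      hx.kpt_mem_cB hp.1 hp.2.1 hp.2.2.2 hp.2.2.1.2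

lemma psi_pos (hΛ : 0 < Λ) (hℓ : 0 ≤ ℓ) (h : Sol r ℓ Λ u K c) (hx : Centre r l x) (hm : 0 < m)
    (hum : ∀ y ∈ cB r, m ≤ u y) (hu2 : ∀ y ∈ cB r, ‖y - x‖ ≤ l → u y ≤ 2)
    (hr : 8 * l ≤ m * (r - ‖x‖)) (hb : 0 ≤ b) (hH : Corr r ℓ m l b u x H) {s₀ ε : ℝ}
    (hs₀ : 0 < s₀)
    (hstart : ∀ y ∈ cB r, s₀ ≤ ‖y - x‖ → kel u x s₀ y + H s₀ y ≤ u y)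
    (hε : 0 < ε) (hεs : (80 * Λ + b ^ 2) * ε < ℓ * s₀ ^ 5 / (2 * r) ^ 4)
    {s : ℝ} (hs : s₀ ≤ s) (hsl : s ≤ l) {y : E3} (hy : y ∈ cB r) (hsy : s ≤ ‖y - x‖) :
    0 < psi u x H b ε s y := by
  set D : Set (ℝ × E3) := {p | s₀ ≤ p.1 ∧ p.1 ≤ l ∧ p.2 ∈ cB r ∧ p.1 ≤ ‖p.2 - x‖} with hD
  have hDc : IsCompact D := by
    have : D = (Icc s₀ l ×ˢ cB r) ∩ {p | p.1 ≤ ‖p.2 - x‖} := by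
      ext p; simp [hD, and_assoc]
    rw [this]
    exact (isCompact_Icc.prod (isCompact_cB r)).inter_right
      (isClosed_le (by fun_prop) (by fun_prop))
  have hcont : ContinuousOn (fun p : ℝ × E3 => psi u x H b ε p.1 p.2) D :=
    (continuousOn_psi h hx hH ε).mono fun p hp => ⟨hs₀.trans_le hp.1, hp.2⟩
  by_contra! hneg
  have hNc : IsCompact (D ∩ {p | psi u x H b ε p.1 p.2 ≤ 0}) := by
    have := hcont.preimage_isClosed_of_isClosed hDc.isClosed (isClosed_Iic (a := (0 : ℝ)))
    exact hDc.of_isClosed_subset this inter_subset_left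
  obtain ⟨⟨t, z⟩, ⟨⟨ht0, htl, hzc, htz⟩, hz0⟩, hmin⟩ := hNc.exists_isMinOn
    ⟨(s, y), ⟨hs, hsl, hy, hsy⟩, hneg⟩ (f := Prod.fst) continuousOn_fst
  simp only [mem_ofPred_eq] at ht0 htl hzc htz hz0
  have hE : ∀ w : E3, 0 < ε * Real.exp (-b * w 2) := fun w => mul_pos hε (Real.exp_pos _)
  have hbelow : ∀ t', s₀ ≤ t' → t' < t → ∀ w ∈ cB r, t' ≤ ‖w - x‖ → 0 < psi u x H b ε t' w := by
    intro t' h1 h2 w hw hw'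
    by_contra! hc
    have : t ≤ t' := hmin (a := (t', w)) ⟨⟨h1, h2.le.trans htl, hw, hw'⟩, hc⟩
    linarith
  have hst : s₀ < t := by
    refine lt_of_le_of_ne ht0 fun e => ?_
    have h1 := hstart z hzc (by rw [e]; exact htz)
    have h2 := hE z
    rw [psi, ← e] at hz0
    linarith
  have htp : 0 < t := hs₀.trans hst
  have hnonneg : ∀ w ∈ cB r, t ≤ ‖w - x‖ → 0 ≤ psi u x H b ε t w := by
    intro w hw htw
    have h1 : ContinuousWithinAt (fun t' => psi u x H b ε t' w) (Icc s₀ t) t :=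
      (hcont (t, w) ⟨hst.le, htl, hw, htw⟩).comp (f := fun t' : ℝ => (t', w))
        (by fun_prop) fun t' ht' => ⟨ht'.1, ht'.2.trans htl, hw, ht'.2.trans htw⟩
    have h2 := h1.mono Ico_subset_Icc_self
    have : (𝓝[Ico s₀ t] t).NeBot := by
      rw [← mem_closure_iff_nhdsWithin_neBot, closure_Ico hst.ne]
      exact ⟨hst.le, le_rfl⟩
    refine ge_of_tendsto h2 ?_
    filter_upwards [self_mem_nhdsWithin] with t' ht'
    exact (hbelow t' ht'.1 ht'.2 w hw (ht'.2.le.trans htw)).le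
  have hzero : psi u x H b ε t z = 0 := le_antisymm hz0 (hnonneg z hzc htz)
  have hHle := hH.le t z htp htl hzc htz
  have htz' : t < ‖z - x‖ := by
    refine lt_of_le_of_ne htz fun e => ?_
    have h1 := hE z
    rw [← e, div_self htp.ne', sub_self, mul_zero] at hHle
    rw [psi, kel, kpt_of_norm_eq htp e.symm, ← e, div_self htp.ne', one_mul] at hzero
    linarith
  have hzx : 0 < ‖z - x‖ := htp.trans htz'
  have hzr : ‖z‖ < r := by
    refine lt_of_le_of_ne hzc.1 fun e => ?_
    have h1 := hE z
    have h2 := kel_le hx hu2 htp htl hzc.2 htz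
    have h3 : r - ‖x‖ ≤ ‖z - x‖ := by rw [← e]; exact norm_sub_norm_le z x
    have h4 : t / ‖z - x‖ ≤ m / 8 := by
      rw [div_le_iff₀ hzx]
      nlinarith
    have h5 : 0 < t / ‖z - x‖ := by positivity
    have h6 := hum z hzc
    rw [psi] at hzero
    nlinarith
  rcases hzc.2.lt_or_eq with hz2 | hz2
  · have hzo : z ∈ oB r := ⟨hzr, hz2⟩
    refine no_interior_contact hΛ hℓ h hx hu2 hb hH htp htl hzo htz' hε (hεs.trans_le ?_) ?_ hzero
    · have hle : ‖z - x‖ ≤ 2 * r := by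
        have := norm_sub_le z x
        linarith [hx.norm_lt, hx.pos]
      gcongr
    · filter_upwards [(isOpen_oB r).mem_nhds hzo,
        (isOpen_lt continuous_const (continuous_id.sub continuous_const).norm).mem_nhds htz']
        with w hw hw'
      rw [hzero]
      exact hnonneg w (oB_subset_cB _ hw) (le_of_lt hw')
  · exact no_flat_contact hm hum hH htp htl ⟨hzr, hz2.symm⟩ htz' hε hnonneg hzero

theorem moving_spheres (hΛ : 0 < Λ) (hℓ : 0 < ℓ) (h : Sol r ℓ Λ u K c) (hx : Centre r l x)
    (hm : 0 < m) (hum : ∀ y ∈ cB r, m ≤ u y) (hu2 : ∀ y ∈ cB r, ‖y - x‖ ≤ l → u y ≤ 2)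
    (hr : 8 * l ≤ m * (r - ‖x‖)) (hb : 0 ≤ b) (hH : Corr r ℓ m l b u x H)
    {s : ℝ} (hs : 0 < s) (hsl : s ≤ l) {y : E3} (hy : y ∈ cB r) (hsy : s ≤ ‖y - x‖) :
    kel u x s y ≤ u y := by
  obtain ⟨s₁, hs₁, hs₁l, hstart⟩ := start_spheres h hx hm hum hu2 hH
  set s₀ := min s s₁
  have hs₀ : 0 < s₀ := lt_min hs hs₁
  have hrp : 0 < r := by linarith [hx.norm_lt, hx.pos, norm_nonneg x]
  have hH0 := hH.nonneg s y hs hsl hy hsy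
  refine le_of_forall_pos_le_add fun δ hδ => ?_
  have hσ : 0 < ℓ * s₀ ^ 5 / (2 * r) ^ 4 := by positivity
  set σ := ℓ * s₀ ^ 5 / (2 * r) ^ 4 with hσd
  set ε := min δ (σ / (2 * (80 * Λ + b ^ 2))) with hεd
  have hA : 0 < 80 * Λ + b ^ 2 := by positivity
  have hε : 0 < ε := lt_min hδ (by positivity)
  have hε2 : (80 * Λ + b ^ 2) * ε < σ := by
    have : ε * (2 * (80 * Λ + b ^ 2)) ≤ σ := by
      rw [← le_div_iff₀ (by positivity)]; exact min_le_right _ _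
    nlinarith
  have key := psi_pos hΛ hℓ.le h hx hm hum hu2 hr hb hH hs₀
    (hstart s₀ hs₀ (min_le_right _ _)) hε hε2 (min_le_left s s₁) hsl hy hsy
  have hexp : Real.exp (-b * y 2) ≤ 1 := Real.exp_le_one_iff.2 (by nlinarith [hy.2])
  have : ε * Real.exp (-b * y 2) ≤ δ := by
    calc ε * Real.exp (-b * y 2) ≤ ε * 1 := mul_le_mul_of_nonneg_left hexp hε.le
      _ ≤ δ := by rw [mul_one]; exact min_le_left _ _
  rw [psi] at key
  linarith

end Moving

lemma jet_inv_norm {z : E3} (hz : z ≠ 0) (i : Fin 3) :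
    HasJet (fun t => ‖z + t • bv i‖⁻¹) (-(z i / ‖z‖ ^ 3))
      (3 / ‖z‖ ^ 5 * z i ^ 2 - 1 / ‖z‖ ^ 3) := by
  have hn : ‖z‖ ≠ 0 := norm_ne_zero_iff.2 hz
  have hρp : 0 < ‖z‖ ^ 2 := by positivity
  have := ((jet_normSq z i).rpow (-(1 / 2)) (by simpa using hρp)).congr_val
    (d' := -(z i / ‖z‖ ^ 3)) (a' := 3 / ‖z‖ ^ 5 * z i ^ 2 - 1 / ‖z‖ ^ 3)
    (by
      simp only [zero_smul, add_zero, inv_norm_eq_rpow]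
      field_simp)
    (by
      simp only [zero_smul, add_zero, inv_norm_eq_rpow]
      field_simp
      ring)
  simpa only [inv_norm_eq_rpow] using this

lemma kel_hasDerivWithinAt {u : E3 → ℝ} {x y : E3} {s : ℝ} {D : E3 →L[ℝ] ℝ} {S : Set E3}
    (hy : y ≠ x) (hD : HasFDerivWithinAt u D S (kpt x s y))
    (hS : ∀ t : ℝ, 0 ≤ t → kpt x s (y + t • e3) ∈ S) :
    HasDerivWithinAt (fun t : ℝ => kel u x s (y + t • e3))
      (-(s * (y - x) 2 / ‖y - x‖ ^ 3) * u (kpt x s y) + s / ‖y - x‖ *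
        (s ^ 2 / ‖y - x‖ ^ 2 * D e3 - 2 * s ^ 2 * (y - x) 2 / ‖y - x‖ ^ 4 * D (y - x)))
      (Ici 0) 0 := by
  set z := y - x with hz
  have hz0 : z ≠ 0 := sub_ne_zero.2 hy
  have hn : ‖z‖ ≠ 0 := norm_ne_zero_iff.2 hz0
  have e1 : ∀ t : ℝ, y + t • e3 - x = z + t • bv 2 := fun t => by rw [hz, bv_two]; abel
  have hA := ((jet_inv_norm hz0 2).const_mul s).hasDerivAt.hasDerivWithinAt (s := Ici 0)
  have hB := (((jet_normSq z 2).inv (by simpa using hn)).const_mul (s ^ 2)).hasDerivAt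
  have hl : HasDerivAt (fun t : ℝ => z + t • bv 2) (bv 2) 0 := by
    simpa using ((hasDerivAt_id (0 : ℝ)).smul_const (bv 2)).const_add z
  have hk := ((hB.smul hl).const_add x).hasDerivWithinAt (s := Ici 0)
  have hcomp : HasDerivWithinAt (u ∘ fun t : ℝ => x + (s ^ 2 * (‖z + t • bv 2‖ ^ 2)⁻¹) •
      (z + t • bv 2)) _ (Ici 0) 0 := HasFDerivWithinAt.comp_hasDerivWithinAt (t := S) 0
    (by simpa [kpt, div_eq_mul_inv] using hD) hk (fun t ht => by
      have := hS t ht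
      rwa [kpt, e1, div_eq_mul_inv] at this)
  refine ((hA.mul hcomp).congr_deriv ?_).congr_of_eventuallyEq (Eventually.of_forall fun t => ?_) ?_
  · simp only [zero_smul, add_zero, map_add, map_smul, smul_eq_mul, Function.comp, bv_two,
      kpt, ← hz, div_eq_mul_inv]
    ring
  · simp only [kel, kpt, e1, div_eq_mul_inv, Pi.mul_apply, Function.comp]
  · simp [kel, kpt, div_eq_mul_inv, ← hz]

/-- The correction used for centres far from the flat boundary. -/
def corrInt (B : ℝ) (x : E3) (s : ℝ) (y : E3) : ℝ := B * (1 - s / ‖y - x‖) ^ 2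

lemma hasJet_corrInt {B s : ℝ} {x y : E3} (hy : y ≠ x) (i : Fin 3) :
    HasJet (fun t => corrInt B x s (y + t • bv i))
      (2 * B * (1 - s / ‖y - x‖) * (s * (y - x) i / ‖y - x‖ ^ 3))
      (B * (2 * (s * (y - x) i / ‖y - x‖ ^ 3) ^ 2 -
        2 * (1 - s / ‖y - x‖) * s * (3 / ‖y - x‖ ^ 5 * (y - x) i ^ 2 - 1 / ‖y - x‖ ^ 3))) := by
  have hz0 : y - x ≠ 0 := sub_ne_zero.2 hy
  have h1 := (HasJet.const 1).sub ((jet_inv_norm hz0 i).const_mul s)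
  have h2 := ((h1.mul h1).const_mul B).congr_val
    (d' := 2 * B * (1 - s / ‖y - x‖) * (s * (y - x) i / ‖y - x‖ ^ 3))
    (a' := B * (2 * (s * (y - x) i / ‖y - x‖ ^ 3) ^ 2 -
        2 * (1 - s / ‖y - x‖) * s * (3 / ‖y - x‖ ^ 5 * (y - x) i ^ 2 - 1 / ‖y - x‖ ^ 3)))
    (by simp only [zero_smul, add_zero]; ring) (by simp only [zero_smul, add_zero]; ring)
  convert h2 using 2 with t
  have e1 : y + t • bv i - x = y - x + t • bv i := by abel
  rw [corrInt, e1]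
  ring

lemma hasLap_corrInt {B s : ℝ} {x y : E3} (hy : y ≠ x) :
    HasLap (corrInt B x s) y (2 * B * s ^ 2 / ‖y - x‖ ^ 4) := by
  refine ⟨_, _, fun i => hasJet_corrInt hy i, ?_⟩
  have hn : ‖y - x‖ ≠ 0 := norm_ne_zero_iff.2 (sub_ne_zero.2 hy)
  have h := norm_sq_coord (y - x)
  rw [Fin.sum_univ_three]
  have e : (y - x) 0 ^ 2 = ‖y - x‖ ^ 2 - (y - x) 1 ^ 2 - (y - x) 2 ^ 2 := by linarith
  simp only [div_pow, mul_pow, e]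
  field_simp
  ring

lemma corr_corrInt {r ℓ Λ m l : ℝ} {u K c : E3 → ℝ} {x : E3} (hΛ : 0 < Λ) (hℓ : 0 < ℓ)
    (h : Sol r ℓ Λ u K c) (hx : Centre r l x) (hum : ∀ y ∈ cB r, m ≤ u y)
    (hu2 : ∀ y ∈ cB r, ‖y - x‖ ≤ l → u y ≤ 2)
    (hgrad : ∀ y, ‖y - x‖ ≤ l → ‖fderiv ℝ u y‖ ≤ 2 * u y)
    (hB : 17 * ℓ * l ^ 3 ≤ m / 4) (hd : 2 * (32 * Λ + 6) * l ^ 2 < x 2) (hlx : l < x 2) :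
    Corr r ℓ m l 0 u x (corrInt (17 * ℓ * l ^ 3) x) := by
  have hl := hx.pos
  set B := 17 * ℓ * l ^ 3 with hBd
  have hB0 : 0 < B := by positivity
  refine ⟨?_, fun s y hs hsl hy hsy => ?_, fun s y hs hsl hy hsy => ?_,
    fun s y hs hsl hy hsy => ?_, fun s y ε hs hsl hy hsy hε h0 huU => ?_⟩
  · unfold corrInt
    refine continuousOn_const.mul ((continuousOn_const.sub (continuousOn_fst.div
      (Continuous.continuousOn (by fun_prop)) fun p hp => ?_)).pow 2)
    exact norm_ne_zero_iff.2 (sub_ne_zero.2 hp.2)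
  · unfold corrInt; positivity
  · have hz : 0 < ‖y - x‖ := hs.trans_le hsy
    have hq1 : s / ‖y - x‖ ≤ 1 := (div_le_one hz).2 hsy
    have hq0 : 0 < s / ‖y - x‖ := by positivity
    rw [corrInt, sq, ← mul_assoc]
    refine mul_le_mul_of_nonneg_right ?_ (by linarith)
    nlinarith
  · have hz : 0 < ‖y - x‖ := hs.trans hsy
    have hyx : y ≠ x := fun e => by simp [e] at hz
    refine ⟨_, hasLap_corrInt hyx, ?_⟩
    have : s ^ 3 ≤ l ^ 3 := pow_le_pow_left₀ hs.le hsl 3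
    have e : 33 * ℓ * s ^ 5 ≤ 2 * B * s ^ 2 := by
      have := mul_le_mul_of_nonneg_left this (by positivity : 0 ≤ 33 * ℓ * s ^ 2)
      have h3 : 0 ≤ ℓ * l ^ 3 * s ^ 2 := by positivity
      rw [hBd]; nlinarith
    gcongr
  · have hz : 0 < ‖y - x‖ := hs.trans hsy
    have hyx : y ≠ x := fun e => by simp [e] at hz
    have hko : kpt x s y ∈ oB r :=
      ⟨hx.kpt_norm_lt hs hsl hsy.le, hx.kpt_pos hs hsl hsy.le (Or.inr hlx)⟩
    have hkl := (norm_kpt_sub_le hs hsy.le).trans hsl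
    have hu' := hu2 _ (oB_subset_cB _ hko) hkl
    have hum' := hum _ (oB_subset_cB _ hko)
    have hg := hgrad _ hkl
    have hup := h.pos _ (oB_subset_cB _ hko)
    obtain ⟨D, hD, hDe⟩ := h.bdry y hy
    have hl1 : HasDerivWithinAt (fun t : ℝ => y + t • e3) e3 (Ici 0) 0 := by
      simpa using (((hasDerivAt_id (0 : ℝ)).smul_const e3).const_add y).hasDerivWithinAt
    have hd1 : HasDerivWithinAt (u ∘ fun t : ℝ => y + t • e3) _ (Ici 0) 0 :=
      HasFDerivWithinAt.comp_hasDerivWithinAt (t := {y : E3 | 0 ≤ y 2}) 0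
      (by simpa using hD) hl1 (fun t ht => by simpa [hy.2, e3_two] using ht)
    have hd2 := kel_hasDerivWithinAt (S := univ) hyx
      ((h.smooth _ hko).differentiableAt (by simp)).hasFDerivAt.hasFDerivWithinAt
      (fun t _ => mem_univ _)
    have hd3 := (hasJet_corrInt (B := B) (s := s) hyx 2).hasDerivAt.hasDerivWithinAt (s := Ici 0)
    have hd4 := ((hd1.sub hd2).sub hd3).add_const ε
    refine ⟨_, ?_, hd4.congr_of_eventuallyEq (Eventually.of_forall fun t => by simp [bv_two])
      (by simp [bv_two])⟩
    have hz2 : (y - x) 2 = - x 2 := by simp [hy.2]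
    rw [hDe, hz2]
    set z := y - x
    set v := u (kpt x s y) with hv
    set G := fderiv ℝ u (kpt x s y)
    have hG1 : -(2 * v) ≤ G e3 := by
      have := G.le_opNorm e3
      rw [norm_e3, mul_one, Real.norm_eq_abs] at this
      linarith [neg_abs_le (G e3)]
    have hG2 : -(2 * v * ‖z‖) ≤ G z := by
      have := G.le_opNorm z
      rw [Real.norm_eq_abs] at this
      nlinarith [neg_abs_le (G z), norm_nonneg z]
    have hq0 : 0 < s / ‖z‖ := by positivity
    have hx2 : x 2 ≤ ‖z‖ := by
      have h1 := abs_coord_le z 2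
      have h2 : z 2 = - x 2 := hz2
      rw [h2, abs_neg] at h1
      exact (le_abs_self _).trans h1
    have hx0 : 0 < x 2 := hl.trans hlx
    have hw : 0 < s / ‖z‖ ^ 3 := by positivity
    have hs2 : s ^ 2 ≤ l ^ 2 := pow_le_pow_left₀ hs.le hsl 2
    set w := s / ‖z‖ ^ 3 with hwd
    have hkel : kel u x s y = s / ‖z‖ * v := rfl
    have hv2 : v ^ 2 ≤ 4 := by nlinarith
    have t1 : c y * u y ^ 3 ≤ w * (32 * Λ * s ^ 2 * v) := by
      have hup := h.pos y (fB_subset_cB _ hy)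
      calc c y * u y ^ 3 ≤ Λ * (2 * (s / ‖z‖ * v)) ^ 3 :=
            mul_le_mul ((le_abs_self _).trans (h.c_le y hy))
              (pow_le_pow_left₀ hup.le (hkel ▸ huU) 3) (by positivity) hΛ.le
        _ = 8 * Λ * w * s ^ 2 * v * v ^ 2 := by rw [hwd]; field_simp; ring
        _ ≤ 8 * Λ * w * s ^ 2 * v * 4 := by gcongr
        _ = _ := by ring
    have t2 : -(w * (2 * s ^ 2 * v)) ≤ s / ‖z‖ * (s ^ 2 / ‖z‖ ^ 2 * G e3) := by
      have e : s / ‖z‖ * (s ^ 2 / ‖z‖ ^ 2 * G e3) = w * s ^ 2 * G e3 := by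
        rw [hwd]; field_simp
      have := mul_le_mul_of_nonneg_left hG1 (by positivity : 0 ≤ w * s ^ 2)
      rw [e]; linarith
    have t3 : -(w * (4 * s ^ 2 * v)) ≤
        -(s / ‖z‖ * (2 * s ^ 2 * -x 2 / ‖z‖ ^ 4 * G z)) := by
      have e : -(s / ‖z‖ * (2 * s ^ 2 * -x 2 / ‖z‖ ^ 4 * G z)) =
          w * (2 * s ^ 2) * (x 2 / ‖z‖ ^ 2) * G z := by
        rw [hwd]; field_simp
      have h1 := mul_le_mul_of_nonneg_left hG2
        (by positivity : 0 ≤ w * (2 * s ^ 2) * (x 2 / ‖z‖ ^ 2))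
      have e2 : w * (2 * s ^ 2) * (x 2 / ‖z‖ ^ 2) * -(2 * v * ‖z‖) =
          -(w * (4 * s ^ 2 * v) * (x 2 / ‖z‖)) := by
        field_simp; ring
      have h3 : x 2 / ‖z‖ ≤ 1 := (div_le_one hz).2 hx2
      have h4 := mul_le_mul_of_nonneg_left h3 (by positivity : 0 ≤ w * (4 * s ^ 2 * v))
      rw [e]; linarith
    have t4 : 2 * B * (1 - s / ‖z‖) * (w * x 2) ≤ v / 2 * (w * x 2) := by
      refine mul_le_mul_of_nonneg_right ?_ (by positivity)
      have : 0 < 2 * B * (s / ‖z‖) := by positivity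
      linarith
    have t5 : 0 < w * v * (x 2 - (64 * Λ + 12) * s ^ 2) := by
      refine mul_pos (by positivity) ?_
      have := mul_le_mul_of_nonneg_left hs2 (by positivity : 0 ≤ 64 * Λ + 12)
      linarith
    have e5 : -(s * -x 2 / ‖z‖ ^ 3) = w * x 2 := by rw [hwd]; ring
    have e6 : s * -x 2 / ‖z‖ ^ 3 = -(w * x 2) := by rw [hwd]; ring
    rw [e5, e6]
    linarith

/-- The square root of `s / ‖y - x‖`. -/
def tau (x : E3) (s : ℝ) (y : E3) : ℝ := √s * (‖y - x‖ ^ 2) ^ (-(1 / 4) : ℝ)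

/-- The height of the inversion of `y`, divided by the radius. -/
def hgt (x : E3) (s : ℝ) (y : E3) : ℝ := s * ((y - x) 2 * (‖y - x‖ ^ 2)⁻¹)

/-- The correction used for centres on the flat boundary. -/
def corrBd (A N Γ : ℝ) (x : E3) (s : ℝ) (y : E3) : ℝ :=
  A * s ^ 2 * ((Real.exp (N * (1 - tau x s y)) - 1) * Real.exp (Γ * hgt x s y))

section

variable {x y : E3} {s : ℝ}

lemma tau_sq (hs : 0 < s) : tau x s y ^ 2 = s / ‖y - x‖ := by
  have e : ((‖y - x‖ ^ 2) ^ (-(1 / 4) : ℝ)) ^ 2 = (‖y - x‖ ^ 2) ^ (-(1 / 2) : ℝ) := by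
    rw [← Real.rpow_natCast, ← Real.rpow_mul (by positivity)]
    norm_num
  rw [tau, mul_pow, Real.sq_sqrt hs.le, e, inv_norm_eq_rpow, div_eq_mul_inv]

lemma tau_pos (hs : 0 < s) (hy : 0 < ‖y - x‖) : 0 < tau x s y := by
  unfold tau; positivity

lemma tau_le_one (hs : 0 < s) (hy : s ≤ ‖y - x‖) : tau x s y ≤ 1 := by
  have h1 := tau_sq (x := x) (y := y) hs
  have h2 : s / ‖y - x‖ ≤ 1 := (div_le_one (hs.trans_le hy)).2 hy
  by_contra! h
  nlinarith

lemma jet_tau (hy : y ≠ x) (i : Fin 3) :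
    HasJet (fun t => tau x s (y + t • bv i)) (-(tau x s y * (y - x) i / (2 * ‖y - x‖ ^ 2)))
      (5 / 4 * tau x s y * (y - x) i ^ 2 / ‖y - x‖ ^ 4 - tau x s y / (2 * ‖y - x‖ ^ 2)) := by
  have hn : ‖y - x‖ ≠ 0 := norm_ne_zero_iff.2 (sub_ne_zero.2 hy)
  have hρp : 0 < ‖y - x‖ ^ 2 := by positivity
  have := (((jet_normSq (y - x) i).rpow (-(1 / 4)) (by simpa using hρp)).const_mul √s).congr_val
    (d' := -(tau x s y * (y - x) i / (2 * ‖y - x‖ ^ 2)))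
    (a' := 5 / 4 * tau x s y * (y - x) i ^ 2 / ‖y - x‖ ^ 4 - tau x s y / (2 * ‖y - x‖ ^ 2))
    (by
      simp only [zero_smul, add_zero, tau]
      field_simp
      ring)
    (by
      simp only [zero_smul, add_zero, tau]
      field_simp
      ring)
  convert this using 2 with t
  rw [tau, add_sub_right_comm]

lemma jet_hgt (hy : y ≠ x) (i : Fin 3) :
    HasJet (fun t => hgt x s (y + t • bv i))
      (s * (bv i 2 / ‖y - x‖ ^ 2 - 2 * (y - x) 2 * (y - x) i / ‖y - x‖ ^ 4))
      (s * ((y - x) 2 * (8 * (y - x) i ^ 2 / ‖y - x‖ ^ 6 - 2 / ‖y - x‖ ^ 4) -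
        4 * bv i 2 * (y - x) i / ‖y - x‖ ^ 4)) := by
  have hn : ‖y - x‖ ≠ 0 := norm_ne_zero_iff.2 (sub_ne_zero.2 hy)
  have := (((HasJet.quadratic ((y - x) 2) (bv i 2) 0).mul
    ((jet_normSq (y - x) i).inv (by simpa using hn))).const_mul s).congr_val
    (d' := s * (bv i 2 / ‖y - x‖ ^ 2 - 2 * (y - x) 2 * (y - x) i / ‖y - x‖ ^ 4))
    (a' := s * ((y - x) 2 * (8 * (y - x) i ^ 2 / ‖y - x‖ ^ 6 - 2 / ‖y - x‖ ^ 4) -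
        4 * bv i 2 * (y - x) i / ‖y - x‖ ^ 4))
    (by
      simp only [zero_smul, add_zero]
      field_simp
      ring)
    (by
      simp only [zero_smul, add_zero]
      field_simp
      ring)
  convert this using 2 with t
  rw [hgt, add_sub_right_comm]
  simp only [PiLp.add_apply, PiLp.smul_apply, smul_eq_mul]
  ring

lemma hasJet_expProd {φ ψ : ℝ → ℝ} {d a e f : ℝ} (A N Γ : ℝ) (h : HasJet φ d a)
    (k : HasJet ψ e f) :
    HasJet (fun t => A * ((Real.exp (N * (1 - φ t)) - 1) * Real.exp (Γ * ψ t)))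
      (A * Real.exp (Γ * ψ 0) * (-(N * d) * Real.exp (N * (1 - φ 0)) +
        Γ * e * (Real.exp (N * (1 - φ 0)) - 1)))
      (A * Real.exp (Γ * ψ 0) * (Real.exp (N * (1 - φ 0)) * (N ^ 2 * d ^ 2 - N * a) -
        2 * Γ * N * Real.exp (N * (1 - φ 0)) * (d * e) +
        (Real.exp (N * (1 - φ 0)) - 1) * (Γ ^ 2 * e ^ 2 + Γ * f))) := by
  refine (((((((HasJet.const 1).sub h).const_mul N).exp).sub (HasJet.const 1)).mul
    ((k.const_mul Γ).exp)).const_mul A).congr_val ?_ ?_ <;> ring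

lemma hasLap_corrBd (A N Γ : ℝ) (hy : y ≠ x) :
    HasLap (corrBd A N Γ x s) y (A * s ^ 2 * Real.exp (Γ * hgt x s y) *
      (Real.exp (N * (1 - tau x s y)) * (N ^ 2 * tau x s y ^ 2 + N * tau x s y) /
          (4 * ‖y - x‖ ^ 2) -
        Γ * N * Real.exp (N * (1 - tau x s y)) * tau x s y * s * (y - x) 2 / ‖y - x‖ ^ 4 +
        (Real.exp (N * (1 - tau x s y)) - 1) *
          (Γ ^ 2 * s ^ 2 / ‖y - x‖ ^ 4 - 2 * Γ * s * (y - x) 2 / ‖y - x‖ ^ 4))) := by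
  refine ⟨_, _, fun i => hasJet_expProd (A * s ^ 2) N Γ (jet_tau hy i) (jet_hgt hy i), ?_⟩
  have hn : ‖y - x‖ ≠ 0 := norm_ne_zero_iff.2 (sub_ne_zero.2 hy)
  have h := norm_sq_coord (y - x)
  have e : (y - x) 0 ^ 2 = ‖y - x‖ ^ 2 - (y - x) 1 ^ 2 - (y - x) 2 ^ 2 := by linarith
  simp only [zero_smul, add_zero]
  set n := ‖y - x‖
  set T := tau x s y
  set z := y - x
  set E := Real.exp (N * (1 - T))
  set g := Real.exp (Γ * hgt x s y)
  have b0 : bv 0 2 = 0 := by simp [bv_apply]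
  have b1 : bv 1 2 = 0 := by simp [bv_apply]
  have b2 : bv 2 2 = 1 := by simp [bv_apply]
  rw [Fin.sum_univ_three, b0, b1, b2]
  have s1 : (-(T * z 0 / (2 * n ^ 2))) ^ 2 + (-(T * z 1 / (2 * n ^ 2))) ^ 2 +
      (-(T * z 2 / (2 * n ^ 2))) ^ 2 = T ^ 2 / (4 * n ^ 2) := by
    simp only [neg_sq, div_pow, mul_pow, e]
    field_simp
    ring
  have s2 : (5 / 4 * T * z 0 ^ 2 / n ^ 4 - T / (2 * n ^ 2)) +
      (5 / 4 * T * z 1 ^ 2 / n ^ 4 - T / (2 * n ^ 2)) +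
      (5 / 4 * T * z 2 ^ 2 / n ^ 4 - T / (2 * n ^ 2)) = -(T / (4 * n ^ 2)) := by
    rw [e]; field_simp; ring
  have s3 : -(T * z 0 / (2 * n ^ 2)) * (s * (0 / n ^ 2 - 2 * z 2 * z 0 / n ^ 4)) +
      -(T * z 1 / (2 * n ^ 2)) * (s * (0 / n ^ 2 - 2 * z 2 * z 1 / n ^ 4)) +
      -(T * z 2 / (2 * n ^ 2)) * (s * (1 / n ^ 2 - 2 * z 2 * z 2 / n ^ 4)) =
      T * s * z 2 / (2 * n ^ 4) := by
    field_simp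
    linear_combination 2 * T * s * z 2 * e
  have s4 : (s * (0 / n ^ 2 - 2 * z 2 * z 0 / n ^ 4)) ^ 2 +
      (s * (0 / n ^ 2 - 2 * z 2 * z 1 / n ^ 4)) ^ 2 +
      (s * (1 / n ^ 2 - 2 * z 2 * z 2 / n ^ 4)) ^ 2 = s ^ 2 / n ^ 4 := by
    field_simp
    linear_combination 4 * s ^ 2 * z 2 ^ 2 * e
  have s5 : (s * (z 2 * (8 * z 0 ^ 2 / n ^ 6 - 2 / n ^ 4) - 4 * 0 * z 0 / n ^ 4)) +
      (s * (z 2 * (8 * z 1 ^ 2 / n ^ 6 - 2 / n ^ 4) - 4 * 0 * z 1 / n ^ 4)) +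
      (s * (z 2 * (8 * z 2 ^ 2 / n ^ 6 - 2 / n ^ 4) - 4 * 1 * z 2 / n ^ 4)) =
      -(2 * s * z 2 / n ^ 4) := by
    field_simp
    linear_combination 8 * s * z 2 * e
  linear_combination (A * s ^ 2 * g) * (E * N ^ 2 * s1 - E * N * s2 - 2 * Γ * N * E * s3 +
    (E - 1) * Γ ^ 2 * s4 + (E - 1) * Γ * s5)

lemma continuousOn_corrBd (A N Γ : ℝ) (x : E3) :
    ContinuousOn (fun p : ℝ × E3 => corrBd A N Γ x p.1 p.2) {p | 0 < p.1 ∧ p.2 ≠ x} := by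
  have hn : ∀ p ∈ {p : ℝ × E3 | 0 < p.1 ∧ p.2 ≠ x}, ‖p.2 - x‖ ^ 2 ≠ 0 := fun p hp =>
    pow_ne_zero 2 (norm_ne_zero_iff.2 (sub_ne_zero.2 hp.2))
  have h1 : ContinuousOn (fun p : ℝ × E3 => ‖p.2 - x‖ ^ 2) {p | 0 < p.1 ∧ p.2 ≠ x} :=
    Continuous.continuousOn (by fun_prop)
  have h2 : ContinuousOn (fun p : ℝ × E3 => tau x p.1 p.2) {p | 0 < p.1 ∧ p.2 ≠ x} :=
    (Continuous.continuousOn (by fun_prop)).mul (h1.rpow_const fun p hp => Or.inl (hn p hp))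
  have h3 : ContinuousOn (fun p : ℝ × E3 => hgt x p.1 p.2) {p | 0 < p.1 ∧ p.2 ≠ x} :=
    continuousOn_fst.mul ((Continuous.continuousOn (by fun_prop)).mul (h1.inv₀ hn))
  unfold corrBd
  fun_prop

lemma one_sub_mul_le_exp_sub_one (N : ℝ) {T : ℝ} (hN : 0 ≤ N) (hT0 : 0 ≤ T) (hT : T ≤ 1) :
    N * (1 - T) ≤ Real.exp (N * (1 - T)) - 1 ∧
      Real.exp (N * (1 - T)) - 1 ≤ N * Real.exp N * (1 - T) := by
  have h1 := Real.add_one_le_exp (N * (1 - T))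
  refine ⟨by linarith, ?_⟩
  have h2 := Real.add_one_le_exp (-(N * (1 - T)))
  have h3 : Real.exp (N * (1 - T)) ≤ Real.exp N := Real.exp_le_exp.2 (by nlinarith)
  have h4 : Real.exp (N * (1 - T)) * Real.exp (-(N * (1 - T))) = 1 := by
    rw [← Real.exp_add]; simp
  have h5 := mul_le_mul_of_nonneg_left h2 (Real.exp_pos (N * (1 - T))).le
  have h6 : 0 ≤ N * (1 - T) := mul_nonneg hN (by linarith)
  have h7 := mul_le_mul_of_nonneg_right h3 h6
  nlinarith

lemma lap_corrBd_ge {A N Γ : ℝ} (hA : 0 ≤ A) (hΓ : 1 ≤ Γ) (hN : N = 4 * Γ + 8) (hs : 0 < s)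
    (hsy : s ≤ ‖y - x‖) (hz2 : 0 ≤ (y - x) 2) :
    A * s ^ 3 / ‖y - x‖ ^ 3 ≤ A * s ^ 2 * Real.exp (Γ * hgt x s y) *
      (Real.exp (N * (1 - tau x s y)) * (N ^ 2 * tau x s y ^ 2 + N * tau x s y) /
          (4 * ‖y - x‖ ^ 2) -
        Γ * N * Real.exp (N * (1 - tau x s y)) * tau x s y * s * (y - x) 2 / ‖y - x‖ ^ 4 +
        (Real.exp (N * (1 - tau x s y)) - 1) *
          (Γ ^ 2 * s ^ 2 / ‖y - x‖ ^ 4 - 2 * Γ * s * (y - x) 2 / ‖y - x‖ ^ 4)) := by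
  have hn : 0 < ‖y - x‖ := hs.trans_le hsy
  have hT0 := tau_pos hs hn
  have hT1 := tau_le_one hs hsy
  have hT2 := tau_sq (x := x) (y := y) hs
  have hz2n : (y - x) 2 ≤ ‖y - x‖ := (le_abs_self _).trans (abs_coord_le _ 2)
  have hG : 1 ≤ Real.exp (Γ * hgt x s y) := Real.one_le_exp (by unfold hgt; positivity)
  have hN0 : 0 ≤ N := by linarith
  have hE := one_sub_mul_le_exp_sub_one N hN0 hT0.le hT1
  set n := ‖y - x‖
  set T := tau x s y
  set E := Real.exp (N * (1 - T))
  set G := Real.exp (Γ * hgt x s y)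
  have hE1 : 1 ≤ E := by
    have : 0 ≤ N * (1 - T) := mul_nonneg hN0 (by linarith)
    linarith
  have hw : s * (y - x) 2 / n ^ 4 ≤ T ^ 2 / n ^ 2 := by
    rw [hT2, div_div, div_le_div_iff₀ (by positivity) (by positivity)]
    have : s * (y - x) 2 ≤ s * n := mul_le_mul_of_nonneg_left hz2n hs.le
    calc s * (y - x) 2 * (n * n ^ 2) ≤ s * n * (n * n ^ 2) := by gcongr
      _ = _ := by ring
  have hw0 : 0 ≤ s * (y - x) 2 / n ^ 4 := by positivity
  set w := s * (y - x) 2 / n ^ 4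
  set k := T ^ 2 / n ^ 2 with hk
  have hk0 : 0 < k := by positivity
  have e1 : E * (N ^ 2 * T ^ 2 + N * T) / (4 * n ^ 2) = E * N ^ 2 / 4 * k +
      E * N * T / (4 * n ^ 2) := by rw [hk]; field_simp
  have e2 : Γ * N * E * T * s * (y - x) 2 / n ^ 4 = Γ * N * E * T * w := by ring
  have e3 : 2 * Γ * s * (y - x) 2 / n ^ 4 = 2 * Γ * w := by ring
  have e4 : A * s ^ 3 / n ^ 3 = A * s ^ 2 * k := by rw [hk, hT2]; field_simp
  rw [e1, e2, e3, e4]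
  have f1 : Γ * N * E * T * w ≤ Γ * N * E * k := by
    have a : Γ * N * E * T * w ≤ Γ * N * E * 1 * k := by gcongr
    linarith
  have f2 : (E - 1) * (2 * Γ * w) ≤ E * (2 * Γ * k) :=
    mul_le_mul (by linarith) (by gcongr) (by positivity) (by positivity)
  have f3 : 0 ≤ (E - 1) * (Γ ^ 2 * s ^ 2 / n ^ 4) := mul_nonneg (by linarith) (by positivity)
  have f4 : 0 ≤ E * N * T / (4 * n ^ 2) := by positivity
  have f5 : k ≤ E * N ^ 2 / 4 * k - Γ * N * E * k - E * (2 * Γ * k) := by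
    have a1 : 1 ≤ N ^ 2 / 4 - Γ * N - 2 * Γ := by rw [hN]; nlinarith
    have a2 : 1 * 1 ≤ E * (N ^ 2 / 4 - Γ * N - 2 * Γ) := mul_le_mul hE1 a1 (by norm_num) (by linarith)
    have a3 := mul_le_mul_of_nonneg_right a2 hk0.le
    linarith
  have f6 : k ≤ E * N ^ 2 / 4 * k + E * N * T / (4 * n ^ 2) - Γ * N * E * T * w +
      (E - 1) * (Γ ^ 2 * s ^ 2 / n ^ 4 - 2 * Γ * w) := by linarith
  rw [mul_assoc (A * s ^ 2)]
  refine mul_le_mul_of_nonneg_left (f6.trans ?_) (by positivity)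
  exact le_mul_of_one_le_left (hk0.le.trans f6) hG

lemma flat_ineq {u U ε q T P ℓ s n Λ Γ B N c c' : ℝ} (hΛ : 0 < Λ) (hℓ : 0 < ℓ) (hs : 0 < s)
    (hn : 0 < n) (hq : q = s / n) (hT0 : 0 < T) (hT1 : T ≤ 1) (hT : T ^ 2 = q) (hΓ : 1 ≤ Γ)
    (hN : 12 ≤ N) (hB : 6 ≤ B) (hΓs : 56 * Λ * s ≤ Γ) (hP : N * (1 - T) ≤ P) (hε : 0 < ε)
    (hu : 0 < u) (hU : 0 ≤ U) (hUq : U ≤ 2 * q) (huU : u ≤ 2 * U)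
    (h0 : u + ε = U + B * ℓ * s ^ 2 * P) (hcl : c - c' ≤ ℓ * ((1 - q ^ 2) * n))
    (hc : -Λ ≤ c ∧ c ≤ Λ) :
    c * u ^ 3 - c' * U ^ 3 - B * ℓ * s ^ 2 * (Γ * (s * (1 / n ^ 2)) * P) +
      ε * -(28 * Λ + 1) < 0 := by
  have hq0 : 0 < q := by rw [hq]; positivity
  have hq1 : q ≤ 1 := by rw [← hT]; nlinarith
  have hsn : s = q * n := by rw [hq]; field_simp
  have hP1 : 12 * (1 - T) ≤ P := by nlinarith
  have hP0 : 0 ≤ P := by linarith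
  set H := B * ℓ * s ^ 2 * P with hH
  have hH0 : 0 ≤ H := by positivity
  have hqT : 1 - q ^ 2 ≤ 4 * (1 - T) := by
    rw [← hT]
    nlinarith [mul_nonneg (sub_nonneg.2 hT1) hT0.le, mul_nonneg (sub_nonneg.2 hT1) (sq_nonneg T),
      mul_nonneg (mul_nonneg (sub_nonneg.2 hT1) hT0.le) (sq_nonneg T),
      pow_le_one₀ hT0.le hT1 (n := 2), pow_le_one₀ hT0.le hT1 (n := 3)]
  have e1 : B * ℓ * s ^ 2 * (Γ * (s * (1 / n ^ 2)) * P) = B * Γ * ℓ * s * q ^ 2 * P := by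
    rw [hq]; field_simp
  have t1 : (c - c') * U ^ 3 ≤ 32 * (ℓ * s * q ^ 2 * (1 - T)) := by
    have : 0 ≤ 1 - q ^ 2 := by nlinarith
    calc (c - c') * U ^ 3 ≤ ℓ * ((1 - q ^ 2) * n) * U ^ 3 := by gcongr
      _ ≤ ℓ * ((1 - q ^ 2) * n) * (2 * q) ^ 3 := by gcongr
      _ ≤ ℓ * ((4 * (1 - T)) * n) * (2 * q) ^ 3 := by gcongr
      _ = _ := by rw [hsn]; ring
  have t2 : 36 * (ℓ * s * q ^ 2 * (1 - T)) ≤ B * Γ * ℓ * s * q ^ 2 * P / 2 := by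
    have hBG : 6 ≤ B * Γ := by nlinarith
    calc 36 * (ℓ * s * q ^ 2 * (1 - T)) = 6 * (ℓ * s * q ^ 2 * (12 * (1 - T))) / 2 := by ring
      _ ≤ (B * Γ) * (ℓ * s * q ^ 2 * P) / 2 := by gcongr
      _ = _ := by ring
  have hd : |u ^ 3 - U ^ 3| ≤ (H + ε) * (28 * q ^ 2) := by
    have : u ^ 3 - U ^ 3 = (u - U) * (u ^ 2 + u * U + U ^ 2) := by ring
    rw [this, abs_mul]
    refine mul_le_mul (abs_le.2 ⟨by linarith, by linarith⟩) ?_ (abs_nonneg _) (by positivity)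
    rw [abs_of_nonneg (by positivity)]
    have hu4 : u ≤ 4 * q := by linarith
    calc u ^ 2 + u * U + U ^ 2 ≤ (4 * q) ^ 2 + (4 * q) * (2 * q) + (2 * q) ^ 2 := by gcongr
      _ = _ := by ring
  have t3 : c * (u ^ 3 - U ^ 3) ≤ Λ * ((H + ε) * (28 * q ^ 2)) := by
    refine (le_abs_self _).trans ?_
    rw [abs_mul]
    exact mul_le_mul (abs_le.2 hc) hd (abs_nonneg _) hΛ.le
  have t4 : Λ * (H * (28 * q ^ 2)) ≤ B * Γ * ℓ * s * q ^ 2 * P / 2 := by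
    calc Λ * (H * (28 * q ^ 2)) = (56 * Λ * s) * (B * ℓ * s * q ^ 2 * P) / 2 := by rw [hH]; ring
      _ ≤ Γ * (B * ℓ * s * q ^ 2 * P) / 2 := by gcongr
      _ = _ := by ring
  have t5 : Λ * (ε * (28 * q ^ 2)) ≤ 28 * Λ * ε := by
    have : q ^ 2 ≤ 1 := pow_le_one₀ hq0.le hq1
    nlinarith [mul_pos hΛ hε]
  have t6 : 0 ≤ ℓ * s * q ^ 2 * (1 - T) := mul_nonneg (by positivity) (by linarith)
  rw [e1]
  linarith

lemma corr_corrBd {r ℓ Λ m l B N Γ : ℝ} {u K c : E3 → ℝ} (hΛ : 0 < Λ) (hℓ : 0 < ℓ)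
    (h : Sol r ℓ Λ u K c) (hx : Centre r l x) (hx2 : x 2 = 0)
    (hu2 : ∀ y ∈ cB r, ‖y - x‖ ≤ l → u y ≤ 2)
    (hΓ : 1 ≤ Γ) (hΓl : 56 * Λ * l ≤ Γ) (hN : N = 4 * Γ + 8) (hB : 33 * l + 6 ≤ B)
    (hm : B * ℓ * l ^ 2 * (N * Real.exp N * Real.exp Γ) ≤ m / 4) :
    Corr r ℓ m l (28 * Λ + 1) u x (corrBd (B * ℓ) N Γ x) := by
  have hl := hx.pos
  have hB0 : 0 < B := by linarith
  have hN0 : 0 < N := by linarith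
  refine ⟨continuousOn_corrBd _ _ _ _, fun s y hs hsl hy hsy => ?_, fun s y hs hsl hy hsy => ?_,
    fun s y hs hsl hy hsy => ?_, fun s y ε hs hsl hy hsy hε h0 huU => ?_⟩
  · have hE := one_sub_mul_le_exp_sub_one N hN0.le (tau_pos hs (hs.trans_le hsy)).le
      (tau_le_one hs hsy)
    have : 0 ≤ N * (1 - tau x s y) := mul_nonneg hN0.le (by linarith [tau_le_one hs hsy])
    have : 0 ≤ Real.exp (N * (1 - tau x s y)) - 1 := by linarith
    unfold corrBd; positivity
  · have hn : 0 < ‖y - x‖ := hs.trans_le hsy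
    have hT0 := tau_pos hs hn
    have hT1 := tau_le_one hs hsy
    have hT2 := tau_sq (x := x) (y := y) hs
    have hE := one_sub_mul_le_exp_sub_one N hN0.le hT0.le hT1
    have hg : hgt x s y ≤ 1 := by
      have h1 : (y - x) 2 ≤ ‖y - x‖ := (le_abs_self _).trans (abs_coord_le _ 2)
      rw [hgt, ← div_eq_mul_inv, mul_div_assoc', div_le_one (by positivity), sq]
      exact mul_le_mul hsy h1 (by simpa [hx2] using hy.2) hn.le
    have hG : Real.exp (Γ * hgt x s y) ≤ Real.exp Γ := Real.exp_le_exp.2 (by nlinarith)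
    have hTq : 1 - tau x s y ≤ 1 - s / ‖y - x‖ := by rw [← hT2]; nlinarith
    have hq : 0 ≤ 1 - tau x s y := by linarith
    have hP : Real.exp (N * (1 - tau x s y)) - 1 ≤ N * Real.exp N * (1 - s / ‖y - x‖) :=
      hE.2.trans (mul_le_mul_of_nonneg_left hTq (by positivity))
    have h1 : 0 ≤ 1 - s / ‖y - x‖ := hq.trans hTq
    calc corrBd (B * ℓ) N Γ x s y
        ≤ B * ℓ * s ^ 2 * ((N * Real.exp N * (1 - s / ‖y - x‖)) * Real.exp Γ) := by
          unfold corrBd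
          gcongr
      _ ≤ B * ℓ * l ^ 2 * ((N * Real.exp N * (1 - s / ‖y - x‖)) * Real.exp Γ) := by gcongr
      _ = B * ℓ * l ^ 2 * (N * Real.exp N * Real.exp Γ) * (1 - s / ‖y - x‖) := by ring
      _ ≤ _ := mul_le_mul_of_nonneg_right hm h1
  · have hn : 0 < ‖y - x‖ := hs.trans hsy
    have hyx : y ≠ x := fun e => by simp [e] at hn
    refine ⟨_, hasLap_corrBd _ _ _ hyx, le_trans ?_ (lap_corrBd_ge (by positivity) hΓ hN hs hsy.le
      (by simpa [hx2] using hy.2.le))⟩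
    rw [div_le_div_iff₀ (by positivity) (by positivity)]
    have h1 : s ^ 2 ≤ l * ‖y - x‖ := by rw [sq]; exact mul_le_mul hsl hsy.le hs.le hl.le
    calc 33 * ℓ * s ^ 5 * ‖y - x‖ ^ 3 = 33 * ℓ * s ^ 3 * ‖y - x‖ ^ 3 * s ^ 2 := by ring
      _ ≤ 33 * ℓ * s ^ 3 * ‖y - x‖ ^ 3 * (l * ‖y - x‖) := by gcongr
      _ = (33 * l) * (ℓ * s ^ 3 * ‖y - x‖ ^ 4) := by ring
      _ ≤ B * (ℓ * s ^ 3 * ‖y - x‖ ^ 4) := by gcongr; linarith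
      _ = _ := by ring
  · have hn : 0 < ‖y - x‖ := hs.trans hsy
    have hyx : y ≠ x := fun e => by simp [e] at hn
    have hz2 : (y - x) 2 = 0 := by simp [hy.2, hx2]
    have hkf : kpt x s y ∈ fB r :=
      ⟨hx.kpt_norm_lt hs hsl hsy.le, by rw [kpt_two, hx2, hy.2]; simp⟩
    have hyc := fB_subset_cB _ hy
    have hUq := kel_le hx hu2 hs hsl hyc.2 hsy.le
    have hU0 := kel_nonneg h hx hs hsl hyc.2 hsy.le
    obtain ⟨D, hD, hDe⟩ := h.bdry y hy
    obtain ⟨D', hD', hDe'⟩ := h.bdry _ hkf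
    have hl1 : HasDerivWithinAt (fun t : ℝ => y + t • e3) e3 (Ici 0) 0 := by
      simpa using (((hasDerivAt_id (0 : ℝ)).smul_const e3).const_add y).hasDerivWithinAt
    have hd1 : HasDerivWithinAt (u ∘ fun t : ℝ => y + t • e3) _ (Ici 0) 0 :=
      HasFDerivWithinAt.comp_hasDerivWithinAt (t := {y : E3 | 0 ≤ y 2}) 0
      (by simpa using hD) hl1 (fun t ht => by simpa [hy.2, e3_two] using ht)
    have hd2 := kel_hasDerivWithinAt hyx hD' (fun t ht => by
      show 0 ≤ kpt x s (y + t • e3) 2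
      rw [kpt_two, hx2]
      simp only [PiLp.add_apply, PiLp.smul_apply, smul_eq_mul, hy.2, e3_two,
        zero_add, mul_one, sub_zero]
      exact mul_nonneg (by positivity) ht)
    have hd3 := (hasJet_expProd (B * ℓ * s ^ 2) N Γ (jet_tau (s := s) hyx 2)
      (jet_hgt (s := s) hyx 2)).hasDerivAt.hasDerivWithinAt (s := Ici 0)
    have hd4 := ((HasJet.quadratic 0 (-(28 * Λ + 1)) 0).exp.hasDerivAt.hasDerivWithinAt
      (s := Ici 0)).const_mul ε
    refine ⟨_, ?_, (((hd1.sub hd2).sub hd3).add hd4).congr_of_eventuallyEq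
      (Eventually.of_forall fun t => by simp [bv_two, corrBd]) (by simp [bv_two, corrBd])⟩
    have hhgt : hgt x s y = 0 := by simp [hgt, hz2]
    have hHd : corrBd (B * ℓ) N Γ x s y =
        B * ℓ * s ^ 2 * (Real.exp (N * (1 - tau x s y)) - 1) := by simp [corrBd, hhgt]
    have hT0 := tau_pos hs hn
    have hT1 := tau_le_one hs hsy.le
    have hT2 := tau_sq (x := x) (y := y) hs
    have hE := one_sub_mul_le_exp_sub_one N hN0.le hT0.le hT1
    have hcl := (le_abs_self _).trans (h.c_lip y hy _ hkf)
    have hcy := abs_le.1 (h.c_le y hy)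
    rw [norm_sub_kpt hs hsy.le] at hcl
    rw [hDe, hDe', hz2]
    simp only [zero_smul, add_zero, mul_zero, zero_div, neg_zero, zero_mul, sub_zero, zero_add,
      hhgt, Real.exp_zero, mul_one, one_mul, bv_apply, if_true, ne_eq, OfNat.ofNat_ne_zero,
      not_false_eq_true, zero_pow]
    have eU : s / ‖y - x‖ * (s ^ 2 / ‖y - x‖ ^ 2 * (c (kpt x s y) * u (kpt x s y) ^ 3)) =
        c (kpt x s y) * kel u x s y ^ 3 := by rw [kel]; field_simp
    rw [eU]
    exact flat_ineq hΛ hℓ hs hn rfl hT0 hT1 hT2 hΓ (by linarith) (by linarith) (by nlinarith)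
      hE.1 hε (h.pos y hyc) hU0 hUq huU (hHd ▸ h0) hcl hcy

end

lemma ray_le {r l : ℝ} {u : E3 → ℝ} {x w : E3} {t : ℝ} (hpos : ∀ y ∈ cB r, 0 < u y)
    (hms : ∀ s y, 0 < s → s ≤ l → y ∈ cB r → s ≤ ‖y - x‖ → kel u x s y ≤ u y)
    (hw : w ≠ 0) (ht : 1 ≤ t) (hl : t * ‖w‖ ≤ l) (hy : x + t • w ∈ cB r) :
    u (x + w) ≤ t * u (x + t • w) := by
  have hw0 : 0 < ‖w‖ := norm_pos_iff.2 hw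
  have ht0 : 0 < t := by linarith
  have hsq : √t ^ 2 = t := Real.sq_sqrt ht0.le
  have hs1 : 1 ≤ √t := Real.one_le_sqrt.2 ht
  have hst : √t ≤ t := by nlinarith
  have hn : ‖x + t • w - x‖ = t * ‖w‖ := by
    rw [add_sub_cancel_left, norm_smul, Real.norm_of_nonneg ht0.le]
  have h1 := hms (√t * ‖w‖) _ (by positivity)
    ((mul_le_mul_of_nonneg_right hst hw0.le).trans hl) hy
    (hn ▸ mul_le_mul_of_nonneg_right hst hw0.le)
  have h2 : kpt x (√t * ‖w‖) (x + t • w) = x + w := by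
    rw [kpt, hn, add_sub_cancel_left, smul_smul, mul_pow, hsq]
    congr 1
    convert one_smul ℝ w using 2
    field_simp
  rw [kel, h2, hn] at h1
  have h3 : √t * ‖w‖ / (t * ‖w‖) = (√t)⁻¹ := by
    field_simp; exact hsq
  rw [h3, inv_mul_le_iff₀ (by positivity)] at h1
  exact h1.trans (mul_le_mul_of_nonneg_right hst (hpos _ hy).le)

lemma le_of_hasLap_lt {D : Set E3} {v ψ : E3 → ℝ} (hD : IsCompact D) (hv : ContinuousOn v D)
    (hψ : ContinuousOn ψ D)
    (h : ∀ y ∈ D, ψ y ≤ v y ∨ D ∈ 𝓝 y ∧ ∃ L L', HasLap v y L ∧ HasLap ψ y L' ∧ L < L')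
    {y : E3} (hy : y ∈ D) : ψ y ≤ v y := by
  obtain ⟨z, hz, hmin⟩ := hD.exists_isMinOn ⟨y, hy⟩ (hv.sub hψ)
  have hzy : v z - ψ z ≤ v y - ψ y := hmin hy
  rcases h z hz with h1 | ⟨h1, L, L', hL, hL', hlt⟩
  · linarith
  · have := (hL.sub hL').nonneg_of_isLocalMin (hmin.isLocalMin h1)
    linarith

lemma hasLap_normSq (x y : E3) : HasLap (fun z => ‖z - x‖ ^ 2) y 6 := by
  refine ⟨fun i => 2 * (y - x) i, fun _ => 2, fun i => ?_, by simp; norm_num⟩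
  simpa [sub_add_eq_add_sub] using jet_normSq (y - x) i

lemma hasLap_const (a : ℝ) (y : E3) : HasLap (fun _ => a) y 0 :=
  ⟨_, _, fun _ => HasJet.const a, by simp⟩

lemma hasLap_coord (y : E3) : HasLap (fun z => z 2) y 0 := by
  refine ⟨fun i => if 2 = i then 1 else 0, fun _ => 0, fun i => ?_, by simp⟩
  convert HasJet.quadratic (y 2) (if 2 = i then 1 else 0) 0 using 2 with t
  · simp [bv_apply, mul_comm]
  · simp

lemma hasLap_coord_sq (y : E3) : HasLap (fun z => z 2 ^ 2) y 2 := by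
  refine ⟨fun i => if 2 = i then 2 * y 2 else 0, fun i => if 2 = i then 2 else 0, fun i => ?_,
    by simp⟩
  convert HasJet.quadratic (y 2 ^ 2) (if 2 = i then 2 * y 2 else 0) (if 2 = i then 1 else 0)
    using 2 with t
  · simp only [PiLp.add_apply, PiLp.smul_apply, bv_apply, smul_eq_mul]
    split_ifs <;> ring
  · split_ifs with h2 <;> simp [h2]

namespace Sol

variable {r ℓ Λ : ℝ} {u K c : E3 → ℝ}

/-- A lower bound at the centre of a ball on which the solution is bounded below. -/
lemma le_of_le_ball (h : Sol r ℓ Λ u K c) (hΛ : 0 < Λ) {x : E3} {ρ a : ℝ} (hρ : 0 < ρ)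
    (ha : 0 < a) (hball : closedBall x ρ ⊆ oB r) (hu : ∀ y ∈ closedBall x ρ, a ≤ u y) :
    Λ⁻¹ * a ^ 5 / 12 * ρ ^ 2 ≤ u x := by
  have key := le_of_hasLap_lt (D := closedBall x ρ) (v := u)
    (ψ := fun y => Λ⁻¹ * a ^ 5 / 12 * ρ ^ 2 + -(Λ⁻¹ * a ^ 5 / 12) * ‖y - x‖ ^ 2)
    (isCompact_closedBall _ _) (h.cont.mono (hball.trans (oB_subset_cB _))) (by fun_prop)
    (fun y hy => ?_) (mem_closedBall_self hρ.le)
  · simpa using key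
  · have hua := hu y hy
    rw [mem_closedBall, dist_eq_norm] at hy
    rcases hy.lt_or_eq with hlt | heq
    · refine Or.inr ⟨closedBall_mem_nhds_of_mem (by rwa [mem_ball, dist_eq_norm]), _, _,
        (h.smooth y (hball (by rw [mem_closedBall, dist_eq_norm]; exact hy))).hasLap,
        (hasLap_const _ y).add ((hasLap_normSq x y).const_mul _), ?_⟩
      have hyo : y ∈ oB r := hball (by rw [mem_closedBall, dist_eq_norm]; exact hy)
      have h1 := h.pde y hyo
      have h2 := (h.K_mem y (oB_subset_cB _ hyo)).1
      have h3 : Λ⁻¹ * a ^ 5 ≤ K y * u y ^ 5 := by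
        have : 0 < Λ⁻¹ := inv_pos.2 hΛ
        have : 0 ≤ K y := by linarith
        gcongr
      have h4 : 0 < Λ⁻¹ * a ^ 5 := by positivity
      linarith
    · left
      rw [heq]; linarith

end Sol

lemma nonneg_of_hasDerivAt_of_le {g : ℝ → ℝ} {d a δ : ℝ} (hg : HasDerivAt g d a) (hδ : 0 < δ)
    (h : ∀ t, a < t → t < a + δ → g a ≤ g t) : 0 ≤ d := by
  by_contra! hd
  have h1 := hg.hasDerivWithinAt (s := Ioi a) |>.limsup_slope_le' (by simp) hd
  have h2 : ∀ᶠ t in 𝓝[>] a, t < a + δ :=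
    nhdsWithin_le_nhds (eventually_lt_nhds (by linarith))
  obtain ⟨t, ⟨ht, ht'⟩, ht0 : a < t⟩ := ((h1.and h2).and self_mem_nhdsWithin).exists
  rw [slope_def_field] at ht
  exact absurd ht (not_lt.2 (div_nonneg (by linarith [h t ht0 ht']) (by linarith)))

namespace Sol

variable {r m k Λ : ℝ} {u K c : E3 → ℝ} {x : E3}

lemma interior_ray (hΛ : 0 < Λ) (hk : 0 < k) (hr0 : 0 < r) (h : Sol r (2 * Λ / r) Λ u K c)
    (hm : 0 < m) (hum : ∀ y ∈ cB r, m ≤ u y) (hmr : 512 * k + 1088 * Λ * k ^ 3 ≤ m * r)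
    (hx : ‖x‖ ≤ 7 * r / 8) (hx2 : 3 * k + 8 * (32 * Λ + 6) * k ^ 2 < x 2)
    (hloc : ∀ y, ‖y - x‖ ≤ 4 * k → u y ≤ 2 ∧ ‖fderiv ℝ u y‖ ≤ 2 * u y)
    {ν : E3} (hν : ‖ν‖ = 1) {a : ℝ} (ha : 0 ≤ a) (hak : a ≤ k) :
    u x ≤ (1 + a / k) * u (x + a • ν) := by
  have hk3 : 0 < Λ * k ^ 3 := by positivity
  have hk2 : 0 < (32 * Λ + 6) * k ^ 2 := by positivity
  have hm2 : m ≤ 2 := (hum x ⟨by linarith, by linarith⟩).trans (hloc x (by simpa using hk.le)).1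
  have hrk : 256 * k ≤ r := by nlinarith
  set z := x - k • ν with hz
  have hzx : ‖x - z‖ = k := by
    rw [hz, sub_sub_cancel, norm_smul, hν, Real.norm_of_nonneg hk.le, mul_one]
  have hzn : ‖z‖ ≤ 7 * r / 8 + k := by
    have := norm_sub_le x (k • ν)
    rw [norm_smul, hν, Real.norm_of_nonneg hk.le, mul_one] at this
    linarith
  have hz2 : x 2 - k ≤ z 2 := by
    have := (le_abs_self _).trans (abs_coord_le (x - z) 2)
    rw [hzx, PiLp.sub_apply] at this
    linarith
  have hloc' : ∀ y, ‖y - z‖ ≤ 2 * k → u y ≤ 2 ∧ ‖fderiv ℝ u y‖ ≤ 2 * u y := fun y hy => by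
    refine hloc y ?_
    have := norm_sub_le_norm_sub_add_norm_sub y z x
    rw [norm_sub_rev z x, hzx] at this
    linarith
  have hC : Centre r (2 * k) z := ⟨by linarith, by linarith, Or.inr (by linarith)⟩
  have hℓ : 0 < 2 * Λ / r := by positivity
  have hB : 17 * (2 * Λ / r) * (2 * k) ^ 3 ≤ m / 4 := by
    have : 17 * (2 * Λ / r) * (2 * k) ^ 3 = 272 * Λ * k ^ 3 / r := by ring
    rw [this, div_le_iff₀ hr0]
    linarith
  have hcor := corr_corrInt hΛ hℓ h hC hum (fun y _ hy => (hloc' y hy).1)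
    (fun y hy => (hloc' y hy).2) hB (by linarith) (by linarith)
  have hms := fun s y hs hsl hy hsy => moving_spheres hΛ hℓ h hC hm hum
    (fun y _ hy => (hloc' y hy).1) (by nlinarith) le_rfl hcor (s := s) hs hsl (y := y) hy hsy
  have hw : k • ν ≠ 0 := smul_ne_zero hk.ne' (norm_ne_zero_iff.1 (by rw [hν]; norm_num))
  have hwk : ‖k • ν‖ = k := by rw [norm_smul, hν, Real.norm_of_nonneg hk.le, mul_one]
  have hak' : a / k ≤ 1 := (div_le_one hk).2 hak
  have e1 : z + (1 + a / k) • k • ν = x + a • ν := by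
    rw [hz, smul_smul, add_mul, add_smul, div_mul_cancel₀ _ hk.ne', one_mul]
    abel
  have e2 : z + k • ν = x := by rw [hz]; abel
  have haν : ‖a • ν‖ = a := by rw [norm_smul, hν, Real.norm_of_nonneg ha, mul_one]
  have hmem : x + a • ν ∈ cB r := by
    refine ⟨(norm_add_le _ _).trans (by rw [haν]; linarith), ?_⟩
    have := neg_le_of_abs_le (abs_coord_le (a • ν) 2)
    rw [haν] at this
    rw [PiLp.add_apply]
    linarith
  have key := ray_le (x := z) h.pos hms hw (t := 1 + a / k)
    (by have := div_nonneg ha hk.le; linarith) (by rw [hwk]; nlinarith) (e1 ▸ hmem)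
  rwa [e1, e2] at key

/-- There is no solution on a large half-ball that is nearly maximal far from the flat
boundary. -/
lemma interior_contra (hΛ : 0 < Λ) (hk : k = 384 * Λ + 2) (hr0 : 0 < r)
    (h : Sol r (2 * Λ / r) Λ u K c)
    (hm : 0 < m) (hum : ∀ y ∈ cB r, m ≤ u y) (hmr : 512 * k + 1088 * Λ * k ^ 3 ≤ m * r)
    (hx : ‖x‖ ≤ 7 * r / 8) (hx2 : 3 * k + 8 * (32 * Λ + 6) * k ^ 2 < x 2)
    (hloc : ∀ y, ‖y - x‖ ≤ 4 * k → u y ≤ 2 ∧ ‖fderiv ℝ u y‖ ≤ 2 * u y)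
    (hux : u x = 1 ∨ ‖fderiv ℝ u x‖ = u x) : False := by
  have hk0 : 2 < k := by linarith
  have hray := fun ν (hν : ‖ν‖ = 1) a ha hak => h.interior_ray hΛ (by linarith) hr0 hm hum hmr hx
    hx2 hloc (ν := ν) hν (a := a) ha hak
  have hk3 : 0 < Λ * k ^ 3 := by positivity
  have hk2 : 0 < (32 * Λ + 6) * k ^ 2 := by positivity
  have hxo : x ∈ oB r := ⟨by linarith, by linarith⟩
  have hup := h.pos x (oB_subset_cB _ hxo)
  have hm2 : m ≤ 2 := (hum x (oB_subset_cB _ hxo)).trans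
    (hloc x (by simpa using by linarith)).1
  have hrk : 256 * k ≤ r := by nlinarith
  have hfd := ((h.smooth x hxo).differentiableAt (by simp)).hasFDerivAt
  have hdir : ∀ ν : E3, ‖ν‖ = 1 → -(u x / k) ≤ fderiv ℝ u x ν := fun ν hν => by
    have h1 : HasDerivAt (fun t : ℝ => x + t • ν) ν 0 := by
      simpa using ((hasDerivAt_id (0 : ℝ)).smul_const ν).const_add x
    have h2 : HasDerivAt (u ∘ fun t : ℝ => x + t • ν) (fderiv ℝ u x ν) 0 :=
      HasFDerivAt.comp_hasDerivAt 0 (by simpa using hfd) h1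
    have h3 : HasDerivAt (fun t : ℝ => 1 + t / k) (1 / k) 0 :=
      ((hasDerivAt_id (0 : ℝ)).div_const k).const_add 1
    have h4 := nonneg_of_hasDerivAt_of_le (h3.mul h2) (δ := k) (by linarith) fun t h1 h2 => by
      simpa using hray ν hν t h1.le (by linarith)
    simp only [Function.comp_apply, zero_smul, add_zero, zero_div, one_mul] at h4
    have : 1 / k * u x = u x / k := by ring
    linarith
  have hnorm : ‖fderiv ℝ u x‖ ≤ u x / k := by
    refine ContinuousLinearMap.opNorm_le_of_unit_norm (by positivity) fun ν hν => ?_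
    have h1 := hdir ν hν
    have h2 := hdir (-ν) (by rwa [norm_neg])
    rw [map_neg] at h2
    exact abs_le.2 ⟨h1, by linarith⟩
  have hux1 : u x = 1 := by
    refine hux.resolve_right fun h1 => ?_
    rw [h1, le_div_iff₀ (by linarith)] at hnorm
    nlinarith
  have hhalf : ∀ y ∈ closedBall x k, 1 / 2 ≤ u y := fun y hy => by
    rw [mem_closedBall, dist_eq_norm] at hy
    rcases eq_or_ne y x with rfl | hyx
    · rw [hux1]; norm_num
    · have hn : 0 < ‖y - x‖ := norm_pos_iff.2 (sub_ne_zero.2 hyx)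
      have h1 := hray (‖y - x‖⁻¹ • (y - x)) (by rw [norm_smul, norm_inv, norm_norm]; field_simp)
        ‖y - x‖ hn.le hy
      rw [smul_smul, mul_inv_cancel₀ hn.ne', one_smul, add_sub_cancel, hux1] at h1
      have h2 : ‖y - x‖ / k ≤ 1 := (div_le_one (by linarith)).2 hy
      have h3 : 0 ≤ ‖y - x‖ / k := by positivity
      nlinarith
  have hball : closedBall x k ⊆ oB r := fun y hy => by
    rw [mem_closedBall, dist_eq_norm] at hy
    have h1 := norm_add_le (y - x) x
    have h2 := neg_le_of_abs_le (abs_coord_le (y - x) 2)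
    rw [sub_add_cancel] at h1
    rw [PiLp.sub_apply] at h2
    exact ⟨by linarith, by linarith⟩
  have key := h.le_of_le_ball hΛ (by linarith) (by norm_num : (0 : ℝ) < 1 / 2) hball hhalf
  have e : Λ⁻¹ * (1 / 2) ^ 5 / 12 * k ^ 2 = k ^ 2 / (384 * Λ) := by field_simp; norm_num
  rw [hux1, e, div_le_one (by positivity)] at key
  nlinarith

end Sol

/-- A lower bound for the product `m * r` that makes the method of moving spheres work for
centres on the flat boundary. -/
def bdConst (Λ L : ℝ) : ℝ :=
  512 * L + 8 * Λ * ((132 * L + 6) * (4 * L) ^ 2 *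
    ((4 * (1 + 224 * Λ * L) + 8) * Real.exp (4 * (1 + 224 * Λ * L) + 8) *
      Real.exp (1 + 224 * Λ * L)))

/-- The horizontal displacement from `p`. -/
def hor (p y : E3) : E3 := y - p - y 2 • e3

lemma e3_apply (i : Fin 3) : e3 i = if i = 2 then 1 else 0 := by simp [e3]

lemma norm_hor_sq (p y : E3) : ‖hor p y‖ ^ 2 = (y 0 - p 0) ^ 2 + (y 1 - p 1) ^ 2 + p 2 ^ 2 := by
  rw [norm_sq_coord]
  simp [hor, e3_apply]

lemma hor_two {p : E3} (hp : p 2 = 0) (y : E3) : hor p y 2 = 0 := by simp [hor, e3_apply, hp]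

lemma continuous_hor (p : E3) : Continuous (hor p) := by
  have := continuous_coord 2
  unfold hor
  fun_prop

lemma norm_sub_sq_eq {p : E3} (hp : p 2 = 0) (y : E3) :
    ‖y - p‖ ^ 2 = ‖hor p y‖ ^ 2 + y 2 ^ 2 := by
  rw [norm_hor_sq, norm_sq_coord]
  simp [hp]

namespace Sol

variable {r m L Λ : ℝ} {u K c : E3 → ℝ} {x : E3}

lemma boundary_ray (hΛ : 0 < Λ) (hL : 0 < L) (hr0 : 0 < r) (h : Sol r (2 * Λ / r) Λ u K c)
    (hm : 0 < m) (hum : ∀ y ∈ cB r, m ≤ u y) (hmr : bdConst Λ L ≤ m * r)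
    (hx : ‖x‖ ≤ 3 * r / 4) (hx0 : 0 ≤ x 2) (hx2 : 32 * x 2 ≤ L) (hux : u x = 1)
    (hloc : ∀ y ∈ cB r, ‖y - x‖ ≤ 8 * L → u y ≤ 2)
    {ν : E3} (hν : ‖ν‖ = 1) (hν2 : ν 2 = 0) {t : ℝ} (ht : 1 ≤ t) (ht2 : t ≤ 3 / 2) :
    1 ≤ t * u (x - x 2 • e3 + ((t - 1) * (2 * L)) • ν + (t * x 2) • e3) := by
  set E := (4 * (1 + 224 * Λ * L) + 8) * Real.exp (4 * (1 + 224 * Λ * L) + 8) *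
      Real.exp (1 + 224 * Λ * L) with hE
  have hΛL : 0 < Λ * L := by positivity
  have hmr' : 512 * L + 8 * Λ * ((132 * L + 6) * (4 * L) ^ 2 * E) ≤ m * r := hmr
  have hE0 : 0 < 8 * Λ * ((132 * L + 6) * (4 * L) ^ 2 * E) := by positivity
  have hm1 : m ≤ 1 := (hum x ⟨by linarith, hx0⟩).trans_eq hux
  have hrL : 512 * L ≤ r := by nlinarith
  set T := x 2
  set w := (2 * L) • ν + T • e3 with hw
  set z := x - w with hz
  have hLν : ‖(2 * L) • ν‖ = 2 * L := by
    rw [norm_smul, hν, Real.norm_of_nonneg (by positivity), mul_one]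
  have hwn : ‖w‖ ≤ 2 * L + T := by
    refine (norm_add_le _ _).trans_eq ?_
    rw [hLν, norm_smul, norm_e3, Real.norm_of_nonneg hx0, mul_one]
  have hw2 : w 2 = T := by simp [hw, hν2, e3_two]
  have hz2 : z 2 = 0 := by rw [hz, PiLp.sub_apply, hw2]; exact sub_self _
  have hw0 : w ≠ 0 := fun h0 => by
    have h1 : T = 0 := by rw [← hw2, h0]; rfl
    rw [hw, h1, zero_smul, add_zero] at h0
    rw [h0, norm_zero] at hLν
    linarith
  have hzn : ‖z‖ ≤ 3 * r / 4 + 3 * L := by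
    have := norm_sub_le x w
    linarith
  have hC : Centre r (4 * L) z := ⟨by positivity, by linarith, Or.inl hz2⟩
  have hu2 : ∀ y ∈ cB r, ‖y - z‖ ≤ 4 * L → u y ≤ 2 := fun y hy hyz => by
    refine hloc y hy ?_
    have : y - x = (y - z) - w := by rw [hz]; abel
    rw [this]
    exact (norm_sub_le _ _).trans (by linarith)
  have hℓ : 0 < 2 * Λ / r := by positivity
  have hcor := corr_corrBd (m := m) (B := 132 * L + 6) (Γ := 1 + 224 * Λ * L) hΛ hℓ h hC hz2 hu2
    (by linarith) (by linarith) rfl (by linarith) (by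
      rw [← hE]
      have : (132 * L + 6) * (2 * Λ / r) * (4 * L) ^ 2 * E =
        2 * Λ * ((132 * L + 6) * (4 * L) ^ 2 * E) / r := by ring
      rw [this, div_le_iff₀ hr0]
      linarith)
  have hms := fun s y hs hsl hy hsy => moving_spheres hΛ hℓ h hC hm hum hu2 (by nlinarith)
    (by positivity) hcor (s := s) hs hsl (y := y) hy hsy
  have htw : t * ‖w‖ ≤ 4 * L := by nlinarith [norm_nonneg w]
  have hmem : z + t • w ∈ cB r := by
    refine ⟨(norm_add_le _ _).trans ?_, ?_⟩
    · rw [norm_smul, Real.norm_of_nonneg (by linarith)]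
      linarith
    · rw [PiLp.add_apply, hz2, PiLp.smul_apply, hw2, zero_add]
      exact mul_nonneg (by linarith) hx0
  have key := ray_le h.pos hms hw0 ht htw hmem
  have e1 : z + w = x := by rw [hz]; abel
  have e2 : z + t • w = x - T • e3 + ((t - 1) * (2 * L)) • ν + (t * T) • e3 := by
    rw [hz, hw, mul_comm (t - 1)]
    simp only [smul_add, smul_smul, mul_sub, sub_smul, mul_one]
    rw [mul_comm t (2 * L)]
    abel
  rwa [e1, e2, hux] at key

end Sol

/-- The harmonic polynomial used as a barrier over the flat boundary. -/
def barrier (L : ℝ) (p y : E3) : ℝ :=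
  1 / 2 + -(1 / (2 * L ^ 2)) * ‖y - p‖ ^ 2 + 3 / (2 * L ^ 2) * y 2 ^ 2 + -(2 / L) * y 2

lemma continuous_barrier (L : ℝ) (p : E3) : Continuous (barrier L p) := by
  have := continuous_coord 2
  unfold barrier
  fun_prop

lemma hasLap_barrier (L : ℝ) (p y : E3) : HasLap (barrier L p) y 0 := by
  have := (((hasLap_const (1 / 2) y).add ((hasLap_normSq p y).const_mul (-(1 / (2 * L ^ 2))))).add
    ((hasLap_coord_sq y).const_mul (3 / (2 * L ^ 2)))).add ((hasLap_coord y).const_mul (-(2 / L)))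
  have e : (0 : ℝ) = 0 + -(1 / (2 * L ^ 2)) * 6 + 3 / (2 * L ^ 2) * 2 + -(2 / L) * 0 := by ring
  rw [e]
  exact this

lemma barrier_eq {L : ℝ} {p : E3} (hL : 0 < L) (hp : p 2 = 0) (y : E3) :
    barrier L p y = (1 - (‖hor p y‖ / L) ^ 2 + 2 * (y 2 / L) ^ 2 - 4 * (y 2 / L)) / 2 := by
  rw [barrier, norm_sub_sq_eq hp]
  field_simp
  ring

namespace Sol

variable {r m L Λ : ℝ} {u K c : E3 → ℝ} {x : E3}

/-- There is no solution on a large half-ball that is nearly maximal close to the flat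
boundary. -/
lemma boundary_contra (hΛ : 0 < Λ) (hL : 0 < L) (hr0 : 0 < r) (h : Sol r (2 * Λ / r) Λ u K c)
    (hm : 0 < m) (hum : ∀ y ∈ cB r, m ≤ u y) (hmr : bdConst Λ L ≤ m * r)
    (hx : ‖x‖ ≤ 3 * r / 4) (hx0 : 0 ≤ x 2) (hx2 : 32 * x 2 ≤ L) (hux : u x = 1)
    (hloc : ∀ y ∈ cB r, ‖y - x‖ ≤ 8 * L → u y ≤ 2)
    (hLΛ : 2 < Λ⁻¹ * (1 / 8) ^ 5 / 12 * (L / 16) ^ 2) : False := by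
  have hrL : 512 * L ≤ r := by
    have hm1 : m ≤ 1 := (hum x ⟨by linarith, hx0⟩).trans_eq hux
    have : 512 * L ≤ m * r := le_trans (le_add_of_nonneg_right (by positivity)) hmr
    nlinarith
  have hray := fun ν (hν : ‖ν‖ = 1) hν2 t ht ht2 => h.boundary_ray hΛ hL hr0 hm hum hmr hx hx0
    hx2 hux hloc (ν := ν) hν hν2 (t := t) ht ht2
  set T := x 2
  set p := x - T • e3 with hpd
  have hp2 : p 2 = 0 := by
    rw [hpd, PiLp.sub_apply, PiLp.smul_apply, e3_two, smul_eq_mul, mul_one]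
    exact sub_self _
  have hTe : ‖T • e3‖ = T := by rw [norm_smul, norm_e3, Real.norm_of_nonneg hx0, mul_one]
  have hpn : ‖p‖ ≤ 3 * r / 4 + L := by
    have := norm_sub_le x (T • e3)
    linarith
  have hdec : ∀ y, y = p + hor p y + y 2 • e3 := fun y => by rw [hor]; abel
  set D := {y : E3 | ‖hor p y‖ ≤ L ∧ T * (1 + ‖hor p y‖ / (2 * L)) ≤ y 2 ∧ y 2 ≤ L} with hD
  have c1 := (continuous_hor p).norm
  have c2 := continuous_coord 2
  have c3 : Continuous fun y => T * (1 + ‖hor p y‖ / (2 * L)) := by fun_prop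
  have hD0 : ∀ y ∈ D, 0 ≤ y 2 := fun y hy =>
    le_trans (mul_nonneg hx0 (by positivity)) hy.2.1
  have hDp : ∀ y ∈ D, ‖y - p‖ ≤ 2 * L := fun y hy => by
    have h1 : y - p = hor p y + y 2 • e3 := by rw [hor]; abel
    rw [h1]
    refine (norm_add_le _ _).trans ?_
    rw [norm_smul, norm_e3, Real.norm_of_nonneg (hD0 y hy)]
    linarith [hy.1, hy.2.2]
  have hDc : IsCompact D := by
    refine (isCompact_closedBall p (2 * L)).of_isClosed_subset ?_ fun y hy => by
      rw [mem_closedBall, dist_eq_norm]; exact hDp y hy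
    exact (isClosed_le c1 continuous_const).inter
      ((isClosed_le c3 c2).inter (isClosed_le c2 continuous_const))
  have hDB : D ⊆ cB r := fun y hy => by
    refine ⟨?_, hD0 y hy⟩
    have := norm_add_le (y - p) p
    rw [sub_add_cancel] at this
    linarith [hDp y hy]
  have hmin : ∀ y ∈ D, barrier L p y ≤ u y := fun y hy => by
    refine le_of_hasLap_lt hDc (h.cont.mono hDB) (continuous_barrier L p).continuousOn
      (fun y hy => ?_) hy
    have hy0 := hD0 y hy
    have hup := h.pos y (hDB hy)
    obtain ⟨ha, hT, hb⟩ := hy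
    have hyL0 : 0 ≤ y 2 / L := by positivity
    have hyL1 : y 2 / L ≤ 1 := (div_le_one hL).2 hb
    rcases ha.lt_or_eq with ha' | ha'
    swap
    · left
      rw [barrier_eq hL hp2, ha', div_self hL.ne']
      nlinarith
    rcases hb.lt_or_eq with hb' | hb'
    swap
    · left
      rw [barrier_eq hL hp2, hb', div_self hL.ne']
      nlinarith [sq_nonneg (‖hor p y‖ / L)]
    rcases hT.lt_or_eq with hT' | hT'
    · have hy0' : 0 < y 2 := lt_of_le_of_lt (mul_nonneg hx0 (by positivity)) hT'
      have hyo : y ∈ oB r := by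
        refine ⟨?_, hy0'⟩
        have := norm_add_le (y - p) p
        rw [sub_add_cancel] at this
        linarith [hDp y ⟨ha, hT, hb⟩]
      refine Or.inr ⟨?_, _, _, (h.smooth y hyo).hasLap, hasLap_barrier L p y, ?_⟩
      · filter_upwards [c1.continuousAt.eventually_lt_const ha',
          c3.continuousAt.eventually_lt c2.continuousAt hT',
          c2.continuousAt.eventually_lt_const hb'] with y h1 h2 h3 using ⟨h1.le, h2.le, h3.le⟩
      · have h1 := h.pde y hyo
        have h2 := (h.K_mem y (oB_subset_cB _ hyo)).1
        have h3 : 0 < K y := (inv_pos.2 hΛ).trans_le h2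
        have h4 : 0 < K y * u y ^ 5 := by positivity
        linarith
    · left
      have hψ : barrier L p y ≤ 1 / 2 := by
        rw [barrier_eq hL hp2]
        nlinarith [sq_nonneg (‖hor p y‖ / L)]
      refine hψ.trans ?_
      rcases (norm_nonneg (hor p y)).eq_or_lt with h0 | h0
      · have hyx : y = x := by
          rw [hdec y, norm_eq_zero.1 h0.symm, ← hT', ← h0, hpd]
          simp
        rw [hyx, hux]; norm_num
      · have hq : ‖hor p y‖ / (2 * L) ≤ 1 / 2 := by
          rw [div_le_iff₀ (by positivity)]; linarith
        have hq0 : 0 ≤ ‖hor p y‖ / (2 * L) := by positivity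
        have h1 := hray (‖hor p y‖⁻¹ • hor p y)
          (by rw [norm_smul, norm_inv, norm_norm, inv_mul_cancel₀ h0.ne'])
          (by rw [PiLp.smul_apply, hor_two hp2, smul_zero])
          (1 + ‖hor p y‖ / (2 * L)) (by linarith) (by linarith)
        have e : (1 + ‖hor p y‖ / (2 * L) - 1) * (2 * L) = ‖hor p y‖ := by field_simp; ring
        rw [e, smul_smul, mul_inv_cancel₀ h0.ne', one_smul, mul_comm _ T, hT', ← hdec] at h1
        nlinarith
  set q := p + (L / 8) • e3 with hqd
  have hq2 : q 2 = L / 8 := by simp [hqd, hp2, e3_two]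
  have hnear : ∀ y ∈ closedBall q (L / 16),
      ‖hor p y‖ ≤ L / 16 ∧ L / 16 ≤ y 2 ∧ y 2 ≤ 3 * L / 16 := fun y hy => by
    rw [mem_closedBall, dist_eq_norm] at hy
    have h1 := abs_le.1 ((abs_coord_le (y - q) 2).trans hy)
    rw [PiLp.sub_apply, hq2] at h1
    refine ⟨le_trans ?_ hy, by linarith, by linarith⟩
    refine le_of_sq_le_sq ?_ (norm_nonneg _)
    rw [norm_hor_sq, norm_sq_coord (y - q), hp2]
    have e0 : q 0 = p 0 := by simp [hqd, e3_apply]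
    have e1 : q 1 = p 1 := by simp [hqd, e3_apply]
    simp only [PiLp.sub_apply, e0, e1]
    nlinarith [sq_nonneg (y 2 - q 2)]
  have hlow : ∀ y ∈ closedBall q (L / 16), 1 / 8 ≤ u y := fun y hy => by
    obtain ⟨h1, h2, h3⟩ := hnear y hy
    have hq : ‖hor p y‖ / L ≤ 1 / 16 := by rw [div_le_iff₀ hL]; linarith
    have hq0 : 0 ≤ ‖hor p y‖ / L := by positivity
    have hb : y 2 / L ≤ 3 / 16 := by rw [div_le_iff₀ hL]; linarith
    have hb0 : 1 / 16 ≤ y 2 / L := by rw [le_div_iff₀ hL]; linarith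
    refine le_trans ?_ (hmin y ⟨by linarith, ?_, by linarith⟩)
    · rw [barrier_eq hL hp2]
      nlinarith
    · have : ‖hor p y‖ / (2 * L) ≤ 1 := by rw [div_le_iff₀ (by positivity)]; linarith
      nlinarith
  have hqn : ‖q - p‖ = L / 8 := by
    rw [hqd, add_sub_cancel_left, norm_smul, norm_e3, Real.norm_of_nonneg (by positivity), mul_one]
  have hball : closedBall q (L / 16) ⊆ oB r := fun y hy => by
    refine ⟨?_, by linarith [(hnear y hy).2.1]⟩
    rw [mem_closedBall, dist_eq_norm] at hy
    have h1 := norm_add_le (y - q) (q - p)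
    have h2 := norm_add_le (y - q + (q - p)) p
    rw [sub_add_sub_cancel] at h1 h2
    rw [sub_add_cancel] at h2
    linarith
  have key := h.le_of_le_ball hΛ (by positivity) (by norm_num : (0 : ℝ) < 1 / 8) hball hlow
  have hqu : u q ≤ 2 := by
    refine hloc q (oB_subset_cB _ (hball (mem_closedBall_self (by positivity)))) ?_
    have h1 := norm_sub_le (q - p) (T • e3)
    have e : q - p - T • e3 = q - x := by rw [hpd]; abel
    rw [e] at h1
    linarith
  linarith

end Sol

/-- A point selection (doubling) lemma. -/
lemma exists_doubling_point {S : Set E3} {N : E3 → ℝ} {x : E3} {ρ A : ℝ} (hS : IsClosed S)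
    (hx : x ∈ S) (hA : 0 < A) (hρ : 0 < ρ) (hN : ContinuousOn N (closedBall x ρ ∩ S))
    (hN0 : ∀ y ∈ closedBall x ρ ∩ S, 0 ≤ N y) (hNx : 2 * A ≤ ρ * N x) :
    ∃ z ∈ S, ‖z - x‖ ≤ ρ ∧ N x ≤ N z ∧
      ∀ y ∈ S, N z * ‖y - z‖ ≤ A → ‖y - x‖ ≤ ρ ∧ N y ≤ 2 * N z := by
  have hcx : x ∈ closedBall x ρ ∩ S := ⟨mem_closedBall_self hρ.le, hx⟩
  have hF : ContinuousOn (fun y => (ρ - ‖y - x‖) * N y) (closedBall x ρ ∩ S) :=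
    ContinuousOn.mul (by fun_prop) hN
  obtain ⟨z, hz, hmax⟩ := ((isCompact_closedBall x ρ).inter_right hS).exists_isMaxOn ⟨x, hcx⟩ hF
  have hzx : ‖z - x‖ ≤ ρ := by simpa [dist_eq_norm] using hz.1
  have hNz := hN0 z hz
  have h1 : ρ * N x ≤ (ρ - ‖z - x‖) * N z := by simpa using hmax hcx
  have hσN : 0 < (ρ - ‖z - x‖) * N z := by linarith
  have hNz0 : 0 < N z := pos_of_mul_pos_right hσN (by linarith)
  have hσ : 0 < ρ - ‖z - x‖ := pos_of_mul_pos_left hσN hNz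
  refine ⟨z, hz.2, hzx, ?_, fun y hy hyz => ?_⟩
  · have : ρ * N x ≤ ρ * N z := by nlinarith [norm_nonneg (z - x)]
    exact le_of_mul_le_mul_left this hρ
  · have hyz' : ‖y - z‖ ≤ (ρ - ‖z - x‖) / 2 := by
      have : N z * ‖y - z‖ ≤ N z * ((ρ - ‖z - x‖) / 2) := by linarith
      exact le_of_mul_le_mul_left this hNz0
    have hyx := norm_sub_le_norm_sub_add_norm_sub y z x
    have hyρ : ‖y - x‖ ≤ ρ := by linarith
    refine ⟨hyρ, ?_⟩
    have hyc : y ∈ closedBall x ρ ∩ S := ⟨by rwa [mem_closedBall, dist_eq_norm], hy⟩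
    have h2 : (ρ - ‖y - x‖) * N y ≤ (ρ - ‖z - x‖) * N z := hmax hyc
    have h3 : (ρ - ‖z - x‖) / 2 * N y ≤ (ρ - ‖y - x‖) * N y :=
      mul_le_mul_of_nonneg_right (by linarith) (hN0 y hyc)
    have : (ρ - ‖z - x‖) * N y ≤ (ρ - ‖z - x‖) * (2 * N z) := by linarith
    exact le_of_mul_le_mul_left this hσ

namespace Sol

variable {r m k d L Λ : ℝ} {u K c : E3 → ℝ} {x : E3}

lemma scl_two_mul_div {s : ℝ} (h : Sol r (2 * Λ / r) Λ u K c) (hs : 0 < s) :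
    Sol (s ^ 2 * r) (2 * Λ / (s ^ 2 * r)) Λ (_root_.scl s u) (fun y => K ((s ^ 2)⁻¹ • y))
      (fun y => c ((s ^ 2)⁻¹ • y)) := by
  have e : 2 * Λ / (s ^ 2 * r) = 2 * Λ / r / s ^ 2 := by rw [div_div, mul_comm r]
  rw [e]
  exact h.scl hs

lemma scl_lower {s : ℝ} (hs : 0 < s) (hum : ∀ y ∈ cB r, m ≤ u y) :
    ∀ y ∈ cB (s ^ 2 * r), s⁻¹ * m ≤ _root_.scl s u y := fun y hy => by
  refine mul_le_mul_of_nonneg_left (hum _ ⟨?_, ?_⟩) (by positivity)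
  · rw [norm_smul, Real.norm_of_nonneg (by positivity), inv_mul_le_iff₀ (by positivity)]
    exact hy.1
  · rw [PiLp.smul_apply]
    exact mul_nonneg (by positivity) hy.2

lemma norm_scl_sub {s : ℝ} (hs : 0 < s) (y z : E3) :
    s ^ 2 * ‖(s ^ 2)⁻¹ • y - z‖ = ‖y - s ^ 2 • z‖ := by
  have : y - s ^ 2 • z = s ^ 2 • ((s ^ 2)⁻¹ • y - z) := by
    rw [smul_sub, smul_smul, mul_inv_cancel₀ (by positivity), one_smul]
  rw [this, norm_smul, Real.norm_of_nonneg (by positivity)]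

lemma deep_contra (hΛ : 0 < Λ) (hk : k = 384 * Λ + 2) (hd : d = 3 * k + 8 * (32 * Λ + 6) * k ^ 2)
    (hr0 : 0 < r) (h : Sol r (2 * Λ / r) Λ u K c) (hm : 0 < m) (hum : ∀ y ∈ cB r, m ≤ u y)
    (hmr : 512 * k + 1088 * Λ * k ^ 3 ≤ m * r) (hdr : 8 * d < r)
    (hx : ‖x‖ ≤ 3 * r / 4) (hx2 : 2 * d < x 2) (hux : u x = 1) : False := by
  have hk0 : 2 < k := by linarith
  have hkd : 8 * k ≤ d := by
    rw [hd]
    nlinarith [mul_pos hΛ (by positivity : 0 < k ^ 2)]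
  have hd0 : 0 < d := by linarith
  have hball : closedBall x d ⊆ oB r := fun y hy => by
    rw [mem_closedBall, dist_eq_norm] at hy
    have h1 := norm_add_le (y - x) x
    have h2 := neg_le_of_abs_le (abs_coord_le (y - x) 2)
    rw [sub_add_cancel] at h1
    rw [PiLp.sub_apply] at h2
    exact ⟨by linarith, by linarith⟩
  have hpos : ∀ y ∈ closedBall x d, 0 < u y := fun y hy => h.pos y (oB_subset_cB _ (hball hy))
  set N : E3 → ℝ := fun y => max (u y ^ 2) (‖fderiv ℝ u y‖ / u y) with hN
  have hNc : ContinuousOn N (closedBall x d ∩ univ) := fun y hy => by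
    have hu := h.smooth y (hball hy.1)
    have h1 : ContinuousAt (fderiv ℝ u) y :=
      (hu.fderiv_right (m := 1) (by norm_num)).continuousAt
    have h2 := hu.continuousAt
    have h3 : ContinuousAt N y := (h2.pow 2).max (h1.norm.div h2 (hpos y hy.1).ne')
    exact h3.continuousWithinAt
  have hN1 : 1 ≤ N x := by
    have : u x ^ 2 ≤ N x := le_max_left _ _
    simpa [hux] using this
  obtain ⟨z, -, hzx, hNz, hz⟩ := exists_doubling_point (A := 4 * k) isClosed_univ (mem_univ x)
    (by linarith) hd0 hNc (fun y _ => le_trans (sq_nonneg _) (le_max_left _ _)) (by nlinarith)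
  have hn1 : 1 ≤ N z := hN1.trans hNz
  set s := √(N z) with hs
  have hs2 : s ^ 2 = N z := Real.sq_sqrt (by linarith)
  have hs1 : 1 ≤ s := Real.one_le_sqrt.2 hn1
  have hs0 : 0 < s := by linarith
  have hz2 : d < z 2 := by
    have := neg_le_of_abs_le (abs_coord_le (z - x) 2)
    rw [PiLp.sub_apply] at this
    linarith
  have hzn : ‖z‖ ≤ 7 * r / 8 := by
    have h1 := norm_add_le (z - x) x
    rw [sub_add_cancel] at h1
    linarith
  have e1 : (s ^ 2)⁻¹ • s ^ 2 • z = z := by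
    rw [smul_smul, inv_mul_cancel₀ (by positivity), one_smul]
  have hgrad : ∀ y, ‖fderiv ℝ (_root_.scl s u) y‖ =
      s⁻¹ * (s ^ 2)⁻¹ * ‖fderiv ℝ u ((s ^ 2)⁻¹ • y)‖ := fun y => by
    rw [fderiv_scl, norm_smul, Real.norm_of_nonneg (by positivity)]
  refine (h.scl_two_mul_div hs0).interior_contra (m := s⁻¹ * m) (x := s ^ 2 • z) hΛ hk
    (by positivity) (by positivity) (scl_lower hs0 hum) ?_ ?_ ?_ (fun y hy => ?_) ?_
  · refine hmr.trans ?_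
    have : s⁻¹ * m * (s ^ 2 * r) = s * (m * r) := by field_simp
    rw [this]
    exact le_mul_of_one_le_left (by positivity) hs1
  · rw [norm_smul, Real.norm_of_nonneg (by positivity)]
    nlinarith
  · rw [← hd, PiLp.smul_apply, smul_eq_mul]
    nlinarith
  · rw [← norm_scl_sub hs0, hs2] at hy
    obtain ⟨h1, h2⟩ := hz _ (mem_univ _) hy
    rw [← hs2] at h1 h2
    have hp := hpos _ (by rwa [mem_closedBall, dist_eq_norm])
    have h3 := (le_max_left _ _).trans h2
    have h4 := (le_max_right _ _).trans h2
    rw [div_le_iff₀ hp] at h4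
    constructor
    · have : (s⁻¹ * u ((s ^ 2)⁻¹ • y)) ^ 2 ≤ 2 := by
        rw [mul_pow, inv_pow, inv_mul_le_iff₀ (by positivity)]
        linarith
      show s⁻¹ * u ((s ^ 2)⁻¹ • y) ≤ 2
      nlinarith
    · rw [hgrad]
      show _ ≤ 2 * (s⁻¹ * u ((s ^ 2)⁻¹ • y))
      calc s⁻¹ * (s ^ 2)⁻¹ * ‖fderiv ℝ u ((s ^ 2)⁻¹ • y)‖
          ≤ s⁻¹ * (s ^ 2)⁻¹ * (2 * s ^ 2 * u ((s ^ 2)⁻¹ • y)) := by gcongr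
        _ = _ := by field_simp
  · rw [hgrad, e1]
    show s⁻¹ * u ((s ^ 2)⁻¹ • s ^ 2 • z) = 1 ∨ _ = s⁻¹ * u ((s ^ 2)⁻¹ • s ^ 2 • z)
    rw [e1]
    have hp := hpos z (by rwa [mem_closedBall, dist_eq_norm])
    rcases max_choice (u z ^ 2) (‖fderiv ℝ u z‖ / u z) with h1 | h1
    · left
      have h2 : s ^ 2 = u z ^ 2 := hs2.trans h1
      rw [(pow_left_inj₀ hs0.le hp.le two_ne_zero).1 h2, inv_mul_cancel₀ hp.ne']
    · right
      have h2 : s ^ 2 = ‖fderiv ℝ u z‖ / u z := hs2.trans h1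
      have h3 : ‖fderiv ℝ u z‖ = s ^ 2 * u z := by rw [h2]; field_simp
      rw [h3]
      field_simp

lemma normalized_contra (hΛ : 0 < Λ) (hk : k = 384 * Λ + 2)
    (hd : d = 3 * k + 8 * (32 * Λ + 6) * k ^ 2) (hL : L = 64 * d + 201326592 * Λ + 1)
    (hr0 : 0 < r) (h : Sol r (2 * Λ / r) Λ u K c) (hm : 0 < m) (hum : ∀ y ∈ cB r, m ≤ u y)
    (hmr : bdConst Λ L + (512 * k + 1088 * Λ * k ^ 3) ≤ m * r)
    (hx : ‖x‖ ≤ 3 * r / 4) (hx0 : 0 ≤ x 2) (hux : u x = 1)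
    (hloc : ∀ y ∈ cB r, ‖y - x‖ ≤ 8 * L → u y ≤ 2) : False := by
  have hk0 : 0 < k := by linarith
  have hd0 : 0 < d := by rw [hd]; positivity
  have hL1 : 1 ≤ L := by linarith
  have hc1 : 0 ≤ 512 * k + 1088 * Λ * k ^ 3 := by positivity
  have hc2 : 512 * L ≤ bdConst Λ L := le_add_of_nonneg_right (by positivity)
  rcases le_or_gt (x 2) (2 * d) with hT | hT
  · refine h.boundary_contra hΛ (by linarith) hr0 hm hum (by linarith) hx hx0 (by linarith) hux
      hloc ?_
    have e : Λ⁻¹ * (1 / 8) ^ 5 / 12 * (L / 16) ^ 2 = L ^ 2 / (100663296 * Λ) := by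
      field_simp; norm_num
    rw [e, lt_div_iff₀ (by positivity)]
    nlinarith
  · have hm1 : m ≤ 1 := (hum x ⟨by linarith, hx0⟩).trans_eq hux
    refine h.deep_contra hΛ hk hd hr0 hm hum (by linarith) ?_ hx hT hux
    nlinarith

end Sol

lemma mul_le_of_sol {R m k d L Λ : ℝ} {u K c : E3 → ℝ} {x : E3} (hΛ : 0 < Λ)
    (hk : k = 384 * Λ + 2)
    (hd : d = 3 * k + 8 * (32 * Λ + 6) * k ^ 2) (hL : L = 64 * d + 201326592 * Λ + 1)
    (hR : 0 < R) (h : Sol (2 * R) (Λ / R) Λ u K c) (hm : 0 < m) (hum : ∀ y ∈ cB (2 * R), m ≤ u y)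
    (hx : x ∈ cB R) : u x * m ≤ (bdConst Λ L + (512 * k + 1088 * Λ * k ^ 3)) / R := by
  have hk0 : 0 < k := by linarith
  have hd0 : 0 < d := by rw [hd]; positivity
  have hL1 : 1 ≤ L := by linarith
  have hc1 : 0 ≤ 512 * k + 1088 * Λ * k ^ 3 := by positivity
  have hc2 : 512 * L ≤ bdConst Λ L := le_add_of_nonneg_right (by positivity)
  by_contra! hlt
  rw [div_lt_iff₀ hR] at hlt
  have hsub : closedBall x (R / 2) ∩ {y : E3 | 0 ≤ y 2} ⊆ cB (3 * R / 2) := fun y hy => by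
    refine ⟨?_, hy.2⟩
    have h1 := norm_add_le (y - x) x
    have h2 := hy.1
    rw [mem_closedBall, dist_eq_norm] at h2
    rw [sub_add_cancel] at h1
    linarith [hx.1]
  have hsub2 : cB (3 * R / 2) ⊆ cB (2 * R) := fun y hy => ⟨by linarith [hy.1], hy.2⟩
  have hx' : x ∈ cB (2 * R) := ⟨by linarith [hx.1], hx.2⟩
  have hux := h.pos x hx'
  have hmx := hum x hx'
  have hsq : u x * m * R ≤ u x ^ 2 * R := by
    rw [sq]; gcongr
  obtain ⟨z, hz0, hzx, hNz, hz⟩ := exists_doubling_point (N := fun y => u y ^ 2) (A := 8 * L)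
    (ρ := R / 2) isClosed_upper hx.2 (by linarith) (by linarith)
    ((h.cont.mono (hsub.trans hsub2)).pow 2) (fun y _ => sq_nonneg _) (by
      show _ ≤ R / 2 * u x ^ 2
      linarith)
  have hzc : z ∈ cB (3 * R / 2) := hsub ⟨by rwa [mem_closedBall, dist_eq_norm], hz0⟩
  set M := u z with hM
  have hM0 : 0 < M := h.pos z (hsub2 hzc)
  have hxM : u x ≤ M := le_of_sq_le_sq hNz hM0.le
  have h' : Sol (2 * R) (2 * Λ / (2 * R)) Λ u K c := by
    rwa [mul_div_mul_left _ _ two_ne_zero]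
  have e1 : (M ^ 2)⁻¹ • M ^ 2 • z = z := by
    rw [smul_smul, inv_mul_cancel₀ (by positivity), one_smul]
  refine (h'.scl_two_mul_div hM0).normalized_contra (m := M⁻¹ * m) (x := M ^ 2 • z) hΛ hk hd hL
    (by positivity) (by positivity) (Sol.scl_lower hM0 hum) ?_ ?_ ?_ ?_ (fun y hy hyz => ?_)
  · have e : M⁻¹ * m * (M ^ 2 * (2 * R)) = 2 * (M * m * R) := by field_simp
    have : u x * m * R ≤ M * m * R := by gcongr
    rw [e]
    linarith
  · rw [norm_smul, Real.norm_of_nonneg (by positivity)]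
    have := hzc.1
    nlinarith [sq_nonneg M]
  · rw [PiLp.smul_apply]
    exact mul_nonneg (by positivity) hz0
  · show M⁻¹ * u ((M ^ 2)⁻¹ • M ^ 2 • z) = 1
    rw [e1, ← hM, inv_mul_cancel₀ hM0.ne']
  · rw [← Sol.norm_scl_sub hM0] at hyz
    have hy2 : 0 ≤ ((M ^ 2)⁻¹ • y) 2 := by
      rw [PiLp.smul_apply]
      exact mul_nonneg (by positivity) hy.2
    have h2 : u ((M ^ 2)⁻¹ • y) ^ 2 ≤ 2 * M ^ 2 := (hz _ hy2 hyz).2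
    have : (M⁻¹ * u ((M ^ 2)⁻¹ • y)) ^ 2 ≤ 2 := by
      rw [mul_pow, inv_pow, inv_mul_le_iff₀ (by positivity)]
      linarith
    show M⁻¹ * u ((M ^ 2)⁻¹ • y) ≤ 2
    nlinarith

end MovingSpheres

/-- Proposition thm1 (boundary Harnack-type inequality). -/
theorem stmt0 (Λ : ℝ) (hΛ : 0 < Λ) :
    ∃ C : ℝ, 0 < C ∧
      ∀ (R : ℝ) (u K c : E3 → ℝ), 0 < R →
        (∀ x ∈ cB (3 * R), 0 < u x) →
        ContinuousOn u (cB (3 * R)) →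
        ContDiffOn ℝ 1 u (oB (3 * R) ∪ fB (3 * R)) →
        ContDiffOn ℝ 2 u (oB (3 * R)) →
        ContDiffOn ℝ 1 K (cB (3 * R)) →
        (∀ x ∈ cB (3 * R), Λ⁻¹ ≤ K x ∧ K x ≤ Λ ∧
          ‖fderivWithin ℝ K (cB (3 * R)) x‖ ≤ Λ / R) →
        ContDiffOn ℝ 1 c (fB (3 * R)) →
        (∀ x ∈ fB (3 * R), |c x| ≤ Λ ∧ ‖fderivWithin ℝ c (fB (3 * R)) x‖ ≤ Λ / R) →
        (∀ x ∈ oB (3 * R), lap u x + K x * u x ^ 5 = 0) →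
        (∀ x ∈ fB (3 * R),
          fderivWithin ℝ u (oB (3 * R) ∪ fB (3 * R)) x e3 = c x * u x ^ 3) →
        sSup (u '' cB R) * sInf (u '' cB (2 * R)) ≤ C / R := by
  obtain ⟨k, hk⟩ : ∃ k, k = 384 * Λ + 2 := ⟨_, rfl⟩
  obtain ⟨d, hd⟩ : ∃ d, d = 3 * k + 8 * (32 * Λ + 6) * k ^ 2 := ⟨_, rfl⟩
  obtain ⟨L, hL⟩ : ∃ L, L = 64 * d + 201326592 * Λ + 1 := ⟨_, rfl⟩
  have hk0 : 0 < k := by linarith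
  have hd0 : 0 < d := by rw [hd]; positivity
  have hL0 : 0 < L := by linarith
  refine ⟨bdConst Λ L + (512 * k + 1088 * Λ * k ^ 3), ?_, ?_⟩
  · unfold bdConst; positivity
  intro R u K c hR hpos hcont hu1 hu2 hK1 hK hc1 hc hpde hbd
  have h : Sol (2 * R) (Λ / R) Λ u K c :=
    (sol_of_hypotheses hpos hcont hu1 hu2 hK1 hK hc1 hc hpde hbd).mono (by linarith)
  have hne : ∀ r, 0 < r → (cB r).Nonempty := fun r hr => ⟨0, by simpa using hr.le, le_rfl⟩
  obtain ⟨x, hx, hxe⟩ := (isCompact_cB R).exists_sSup_image_eq (hne R hR)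
    (h.cont.mono fun y hy => ⟨by linarith [hy.1], hy.2⟩)
  obtain ⟨z, hz, hze, hzm⟩ := (isCompact_cB (2 * R)).exists_sInf_image_eq_and_le
    (hne (2 * R) (by linarith)) h.cont
  rw [hxe, hze]
  exact mul_le_of_sol hΛ hk hd hL hR h (h.pos z hz) hzm hx
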